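/- Let 3 ≤ a ≤ b and let p be an integer with p ≥ ab + a. Then κ_{p,1} = p · C((a+1)b, p+1), where C denotes the binomial coefficient. -/

import Mathlib

open MvPolynomial
open scoped TensorProduct

set_option maxHeartbeats 1600000
set_option synthInstance.maxHeartbeats 400000
set_option maxSynthPendingDepth 3

noncomputable section

/-- The space of bihomogeneous polynomials in `k[x,y,z,w]` of bidegree `(d, e)`:
all monomials `x^α y^β z^γ w^δ` occurring satisfy `α + β = d` and `γ + δ = e`. -/
def Bihom (k : Type*) [Field k] (d e : ℕ) : Submodule k (MvPolynomial (Fin 4) k) where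
  carrier := {f | ∀ m ∈ f.support, m 0 + m 1 = d ∧ m 2 + m 3 = e}
  add_mem' := by
    intro f g hf hg m hm
    rcases Finset.mem_union.mp (MvPolynomial.support_add hm) with h | h
    exacts [hf m h, hg m h]
  zero_mem' := by intro m hm; simp at hm
  smul_mem' := by
    intro c f hf m hm
    exact hf m (MvPolynomial.support_smul hm)

/-- `RS k a b q` is the degree-`q` part `R_q` of the homogeneous coordinate ring of the
Segre–Veronese embedding of `ℙ¹×ℙ¹` by `O(a)⊠O(b)`: bihomogeneous polynomials of
bidegree `(q*a, q*b)`. -/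
abbrev RS (k : Type*) [Field k] (a b q : ℕ) : Submodule k (MvPolynomial (Fin 4) k) :=
  Bihom k (q*a) (q*b)

theorem Bihom.mul_mem' {k : Type*} [Field k] {d e d' e' : ℕ} {f g : MvPolynomial (Fin 4) k}
    (hf : f ∈ Bihom k d e) (hg : g ∈ Bihom k d' e') : f * g ∈ Bihom k (d+d') (e+e') := by
  intro m hm
  have h := MvPolynomial.support_mul f g hm
  rw [Finset.mem_add] at h
  obtain ⟨m1, h1, m2, h2, rfl⟩ := h
  obtain ⟨e1, e2⟩ := hf m1 h1
  obtain ⟨e3, e4⟩ := hg m2 h2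
  constructor <;> simp only [Finsupp.add_apply] <;> omega

/-- Multiplication `R_1 × R_q → R_{q+1}`. -/
def segMul (k : Type*) [Field k] (a b q : ℕ) (v : RS k a b 1) (f : RS k a b q) :
    RS k a b (q+1) := by
  refine ⟨(v : MvPolynomial (Fin 4) k) * (f : MvPolynomial (Fin 4) k), ?_⟩
  have h := Bihom.mul_mem' v.2 f.2
  rwa [show 1*a + q*a = (q+1)*a by ring, show 1*b + q*b = (q+1)*b by ring] at h

/-- The wedge product of a family of vectors, as an element of the `n`-th exterior power. -/
def wedge (k : Type*) [Field k] {M : Type*} [AddCommGroup M] [Module k M] (n : ℕ)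
    (v : Fin n → M) : ⋀[k]^n M :=
  ⟨ExteriorAlgebra.ιMulti k n v, ExteriorAlgebra.ιMulti_range k n (Set.mem_range_self v)⟩

/-- The type of a family of Koszul differentials
`δ_{n+1,q} : Λ^{n+1} V ⊗ R_q → Λ^n V ⊗ R_{q+1}` for the Segre–Veronese ring,
where `V = R_1`. -/
abbrev KoszulMaps (k : Type*) [Field k] (a b : ℕ) :=
  ∀ n q : ℕ, ((⋀[k]^(n+1) (RS k a b 1)) ⊗[k] (RS k a b q)) →ₗ[k]
      ((⋀[k]^n (RS k a b 1)) ⊗[k] (RS k a b (q+1)))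

/-- The defining property of the Koszul differentials:
`δ (v_1∧⋯∧v_p ⊗ f) = Σ_i (−1)^{i+1} v_1∧⋯∧v̂_i∧⋯∧v_p ⊗ v_i·f` (1-indexed signs). -/
def IsKoszul (k : Type*) [Field k] (a b : ℕ) (δ : KoszulMaps k a b) : Prop :=
  ∀ (n q : ℕ) (v : Fin (n+1) → RS k a b 1) (f : RS k a b q),
    δ n q (wedge k (n+1) v ⊗ₜ[k] f) =
      ∑ i : Fin (n+1), ((-1:k)^(i:ℕ)) •
        (wedge k n (fun j => v (i.succAbove j)) ⊗ₜ[k] segMul k a b q (v i) f)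

/-- `Kp1 k a b δ n` is the Koszul cohomology `K_{p,1}` for `p = n+1`:
`ker δ_{p,1} / im δ_{p+1,0}`. -/
abbrev Kp1 (k : Type*) [Field k] (a b : ℕ) (δ : KoszulMaps k a b) (n : ℕ) :=
  LinearMap.ker (δ n 1) ⧸
    Submodule.comap (LinearMap.ker (δ n 1)).subtype (LinearMap.range (δ (n+1) 0))

section Fock

variable {k I : Type*} [Field k] [LinearOrder I]

/-- The sign picked up when `v` is moved to its place among the elements of `S`. -/
def koszulSign (k : Type*) [Field k] {I : Type*} [LinearOrder I] (v : I) (S : Finset I) : k :=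
  (-1) ^ (S.filter (· < v)).card

theorem koszulSign_mul_self (v : I) (S : Finset I) : koszulSign k v S * koszulSign k v S = 1 := by
  rw [koszulSign, ← mul_pow]; simp

theorem koszulSign_insert {u v : I} {S : Finset I} (hu : u ∉ S) :
    koszulSign k v (insert u S) = if u < v then -koszulSign k v S else koszulSign k v S := by
  unfold koszulSign
  rw [Finset.filter_insert]
  split_ifs with h
  · rw [Finset.card_insert_of_notMem (by simp [hu]), pow_succ]; ring
  · rfl

theorem koszulSign_insert_self (v : I) (S : Finset I) :
    koszulSign k v (insert v S) = koszulSign k v S := by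
  unfold koszulSign
  rw [Finset.filter_insert]; simp

/-- Contraction with the basis covector `v`, on the exterior algebra written in coordinates:
a form is the family of its coefficients, indexed by finite sets of basis vectors. -/
def contr (v : I) : (Finset I → k) →ₗ[k] (Finset I → k) where
  toFun f S := if v ∈ S then 0 else koszulSign k v S * f (insert v S)
  map_add' f g := by ext S; by_cases h : v ∈ S <;> simp [h, mul_add]
  map_smul' c f := by ext S; by_cases h : v ∈ S <;> simp [h]; ring

/-- Left multiplication by the basis vector `v`, in the coordinates of `contr`. -/
def lmulBasis (v : I) : (Finset I → k) →ₗ[k] (Finset I → k) where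
  toFun f S := if v ∈ S then koszulSign k v S * f (S.erase v) else 0
  map_add' f g := by ext S; by_cases h : v ∈ S <;> simp [h, mul_add]
  map_smul' c f := by ext S; by_cases h : v ∈ S <;> simp [h]; ring

theorem contr_apply (v : I) (f : Finset I → k) (S : Finset I) :
    contr v f S = if v ∈ S then 0 else koszulSign k v S * f (insert v S) := rfl

theorem lmulBasis_apply (v : I) (f : Finset I → k) (S : Finset I) :
    lmulBasis v f S = if v ∈ S then koszulSign k v S * f (S.erase v) else 0 := rfl

theorem contr_contr_self (v : I) (f : Finset I → k) : contr v (contr v f) = 0 := by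
  ext S; simp [contr_apply]

theorem contr_contr_add (u v : I) (f : Finset I → k) :
    contr u (contr v f) + contr v (contr u f) = 0 := by
  rcases eq_or_ne u v with rfl | huv
  · simp [contr_contr_self]
  ext S
  simp only [Pi.add_apply, contr_apply, Finset.mem_insert, Pi.zero_apply, huv, huv.symm, false_or]
  by_cases hu : u ∈ S
  · simp [hu]
  by_cases hv : v ∈ S
  · simp [hv]
  simp only [hu, hv, if_false, koszulSign_insert hu, koszulSign_insert hv,
    Finset.insert_comm v u]
  rcases lt_or_gt_of_ne huv with h | h
  · simp only [h, if_true, h.not_gt, if_false]; ring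
  · simp only [h, if_true, h.not_gt, if_false]; ring

theorem contr_lmulBasis_self_add (v : I) (f : Finset I → k) :
    contr v (lmulBasis v f) + lmulBasis v (contr v f) = f := by
  ext S
  simp only [Pi.add_apply, contr_apply, lmulBasis_apply]
  by_cases hv : v ∈ S
  · have h : koszulSign k v (S.erase v) = koszulSign k v S := by
      rw [← koszulSign_insert_self v (S.erase v), Finset.insert_erase hv]
    simp [hv, h, Finset.insert_erase, ← mul_assoc, koszulSign_mul_self]
  · simp [hv, koszulSign_insert_self, ← mul_assoc, koszulSign_mul_self]

theorem contr_lmulBasis_add {u v : I} (huv : u ≠ v) (f : Finset I → k) :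
    contr u (lmulBasis v f) + lmulBasis v (contr u f) = 0 := by
  ext S
  simp only [Pi.add_apply, contr_apply, lmulBasis_apply, Finset.mem_insert, huv.symm, false_or,
    Pi.zero_apply]
  by_cases hv : v ∈ S
  · by_cases hu : u ∈ S
    · simp [hu, hv, huv]
    · obtain ⟨R, hR, rfl⟩ : ∃ R, v ∉ R ∧ S = insert v R :=
        ⟨S.erase v, by simp, (Finset.insert_erase hv).symm⟩
      have huR : u ∉ R := fun h => hu (Finset.mem_insert_of_mem h)
      have e1 : (insert u (insert v R)).erase v = insert u R := by
        rw [Finset.insert_comm, Finset.erase_insert (by simp [hR, huv.symm])]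
      simp only [hu, hv, if_true, if_false, e1, Finset.erase_insert hR, huR]
      rw [koszulSign_insert hu, koszulSign_insert hR, koszulSign_insert_self]
      rcases lt_or_gt_of_ne huv with h | h
      · simp only [h, if_true, h.not_gt, if_false]; ring
      · simp only [h, if_true, h.not_gt, if_false]; ring
  · simp [hv]

/-- The forms of degree `p` in the basis vectors belonging to `T`. -/
def forms (k : Type*) [Field k] {I : Type*} [LinearOrder I] (T : Finset I) (p : ℕ) :
    Submodule k (Finset I → k) where
  carrier := {f | ∀ S, f S ≠ 0 → S ⊆ T ∧ S.card = p}
  add_mem' := by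
    intro f g hf hg S hS
    by_cases h : f S = 0
    · exact hg S fun h' => hS (by simp [h, h'])
    · exact hf S h
  zero_mem' := by intro S hS; simp at hS
  smul_mem' := by
    intro c f hf S hS
    exact hf S fun h => hS (by simp [h])

theorem forms_mono {T T' : Finset I} (h : T ⊆ T') (p : ℕ) : forms k T p ≤ forms k T' p :=
  fun _ hf S hS => ⟨(hf S hS).1.trans h, (hf S hS).2⟩

theorem contr_mem_forms {T : Finset I} {p : ℕ} {f : Finset I → k} (v : I)
    (hf : f ∈ forms k T (p + 1)) : contr v f ∈ forms k (T.erase v) p := by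
  intro S hS
  rw [contr_apply] at hS
  split_ifs at hS with hv
  · simp at hS
  obtain ⟨h1, h2⟩ := hf _ (right_ne_zero_of_mul hS)
  rw [Finset.card_insert_of_notMem hv] at h2
  refine ⟨fun x hx => Finset.mem_erase.2 ⟨?_, h1 (Finset.mem_insert_of_mem hx)⟩, by omega⟩
  rintro rfl
  exact hv hx

theorem contr_mem_forms' {T : Finset I} {p : ℕ} {f : Finset I → k} (v : I)
    (hf : f ∈ forms k T (p + 1)) : contr v f ∈ forms k T p :=
  forms_mono (T.erase_subset v) p (contr_mem_forms v hf)

theorem contr_forms_zero {T : Finset I} {f : Finset I → k} (v : I)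
    (hf : f ∈ forms k T 0) : contr v f = 0 := by
  ext S
  rw [contr_apply]
  split_ifs with hv
  · rfl
  by_contra h
  have h2 := (hf _ (right_ne_zero_of_mul h)).2
  rw [Finset.card_insert_of_notMem hv] at h2
  omega

theorem contr_eq_zero_of_notMem {T : Finset I} {p : ℕ} {f : Finset I → k} {v : I}
    (hf : f ∈ forms k T p) (hv : v ∉ T) : contr v f = 0 := by
  ext S
  rw [contr_apply]
  split_ifs with hvS
  · rfl
  by_contra h
  exact hv ((hf _ (right_ne_zero_of_mul h)).1 (Finset.mem_insert_self v S))

theorem mem_forms_erase {T : Finset I} {p : ℕ} {f : Finset I → k} {v : I}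
    (hf : f ∈ forms k T p) (hv : contr v f = 0) : f ∈ forms k (T.erase v) p := by
  intro S hS
  obtain ⟨h1, h2⟩ := hf S hS
  refine ⟨fun x hx => Finset.mem_erase.2 ⟨?_, h1 hx⟩, h2⟩
  rintro rfl
  have := congrFun hv (S.erase x)
  rw [contr_apply, if_neg (by simp), Finset.insert_erase hx] at this
  have h3 : koszulSign k x (S.erase x) ≠ 0 := left_ne_zero_of_mul_eq_one (koszulSign_mul_self _ _)
  simp_all

theorem mem_forms_sdiff {T B : Finset I} {p : ℕ} {f : Finset I → k}
    (hf : f ∈ forms k T p) (hB : ∀ v ∈ B, contr v f = 0) : f ∈ forms k (T \ B) p := by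
  intro S hS
  refine ⟨fun x hx => ?_, (hf S hS).2⟩
  refine Finset.mem_sdiff.2 ⟨(hf S hS).1 hx, fun hxB => ?_⟩
  exact Finset.notMem_erase x T ((mem_forms_erase hf (hB x hxB) S hS).1 hx)

theorem eq_zero_of_forms_empty {p : ℕ} {f : Finset I → k} (hf : f ∈ forms k ∅ (p + 1)) :
    f = 0 := by
  ext S
  by_contra h
  obtain ⟨h1, h2⟩ := hf S h
  rw [Finset.subset_empty.1 h1] at h2
  simp at h2

theorem eq_zero_of_contr_eq_zero {T : Finset I} {p : ℕ} {f : Finset I → k}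
    (hf : f ∈ forms k T (p + 1)) (h : ∀ v ∈ T, contr v f = 0) : f = 0 := by
  have := mem_forms_sdiff hf h
  rw [Finset.sdiff_self] at this
  exact eq_zero_of_forms_empty this

theorem lmulBasis_mem_forms {T : Finset I} {p : ℕ} {f : Finset I → k} {v : I} (hv : v ∈ T)
    (hf : f ∈ forms k T p) : lmulBasis v f ∈ forms k T (p + 1) := by
  intro S hS
  rw [lmulBasis_apply] at hS
  split_ifs at hS with hvS
  · obtain ⟨h1, h2⟩ := hf _ (right_ne_zero_of_mul hS)
    refine ⟨fun x hx => ?_, by rw [← Finset.card_erase_add_one hvS, h2]⟩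
    rcases eq_or_ne x v with rfl | hxv
    · exact hv
    · exact h1 (Finset.mem_erase.2 ⟨hxv, hx⟩)
  · simp at hS

/-- Forms in the vectors of `T` are determined by their coefficients. -/
def formsEquiv (T : Finset I) (p : ℕ) : forms k T p ≃ₗ[k] (↥(T.powersetCard p) → k) where
  toFun f S := f.1 S.1
  map_add' _ _ := rfl
  map_smul' _ _ := rfl
  invFun g := ⟨fun S => if h : S ∈ T.powersetCard p then g ⟨S, h⟩ else 0, by
    intro S hS
    by_contra h
    exact hS (dif_neg (by rwa [Finset.mem_powersetCard]))⟩
  left_inv f := by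
    ext S
    by_cases h : S ∈ T.powersetCard p
    · simp [h]
    · simp only [h, dite_false]
      by_contra h'
      exact h (Finset.mem_powersetCard.2 (f.2 S (Ne.symm h')))
  right_inv g := by ext S; simp

theorem finrank_forms (T : Finset I) (p : ℕ) :
    Module.finrank k (forms k T p) = T.card.choose p := by
  rw [(formsEquiv T p).finrank_eq, Module.finrank_fintype_fun_eq_card]
  simp

instance (T : Finset I) (p : ℕ) : Module.Finite k (forms k T p) :=
  Module.Finite.equiv (formsEquiv T p).symm

/-- Contraction systems `contr (v i) η = τ i` are solvable when the obvious
compatibility conditions hold. -/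
theorem exists_contr_eq {J : Type*} [DecidableEq J] {T : Finset I} {p : ℕ} (v : J → I)
    (hv : Function.Injective v) (A : Finset J) (τ : J → Finset I → k) (hvT : ∀ i ∈ A, v i ∈ T)
    (hτ : ∀ i ∈ A, τ i ∈ forms k T p) (hself : ∀ i ∈ A, contr (v i) (τ i) = 0)
    (hpair : ∀ i ∈ A, ∀ j ∈ A, contr (v i) (τ j) + contr (v j) (τ i) = 0) :
    ∃ η ∈ forms k T (p + 1), ∀ i ∈ A, contr (v i) η = τ i := by
  induction A using Finset.induction_on with
  | empty => exact ⟨0, zero_mem _, by simp⟩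
  | insert j A hj ih =>
    have hm : ∀ i ∈ A, i ∈ insert j A := fun i hi => Finset.mem_insert_of_mem hi
    have hjm := Finset.mem_insert_self j A
    obtain ⟨η, hη, h⟩ := ih (fun i hi => hvT i (hm i hi)) (fun i hi => hτ i (hm i hi))
      (fun i hi => hself i (hm i hi)) (fun i hi l hl => hpair i (hm i hi) l (hm l hl))
    refine ⟨η + lmulBasis (v j) (τ j - contr (v j) η), add_mem hη (lmulBasis_mem_forms (hvT j hjm)
      (sub_mem (hτ j hjm) (contr_mem_forms' _ hη))), ?_⟩
    intro i hi
    rcases Finset.mem_insert.1 hi with rfl | hiA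
    · have h1 := contr_lmulBasis_self_add (v i) (τ i - contr (v i) η)
      rw [map_sub (contr (v i)), hself i hi, contr_contr_self, sub_zero, map_zero, add_zero] at h1
      rw [map_add, h1]; abel
    · have hne : v i ≠ v j := fun e => hj (hv e ▸ hiA)
      have h1 := contr_lmulBasis_add hne (τ j - contr (v j) η)
      have h2 : contr (v i) (τ j - contr (v j) η) = 0 := by
        have h3 := contr_contr_add (v i) (v j) η
        rw [h i hiA] at h3
        rw [map_sub, eq_neg_of_add_eq_zero_left h3, sub_neg_eq_add]
        exact hpair i hi j hjm
      rw [h2, map_zero, add_zero] at h1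
      rw [map_add, h1, add_zero, h i hiA]

/-- The component of weight `w` of a form. -/
def weightPart (wt : I → ℤ) (w : ℤ) : (Finset I → k) →ₗ[k] (Finset I → k) where
  toFun f S := if ∑ v ∈ S, wt v = w then f S else 0
  map_add' f g := by ext S; simp only [Pi.add_apply]; split_ifs <;> simp
  map_smul' c f := by ext S; simp

theorem weightPart_apply (wt : I → ℤ) (w : ℤ) (f : Finset I → k) (S : Finset I) :
    weightPart wt w f S = if ∑ v ∈ S, wt v = w then f S else 0 := rfl

theorem contr_weightPart (wt : I → ℤ) (w : ℤ) (v : I) (f : Finset I → k) :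
    contr v (weightPart wt (w + wt v) f) = weightPart wt w (contr v f) := by
  ext S
  simp only [contr_apply, weightPart_apply]
  by_cases hv : v ∈ S
  · simp [hv]
  · simp only [hv, if_false, Finset.sum_insert hv]
    have : (wt v + ∑ x ∈ S, wt x = w + wt v) ↔ ∑ x ∈ S, wt x = w := by
      constructor <;> intro h <;> linarith
    simp only [this]
    split_ifs <;> simp

theorem weightPart_mem_forms {T : Finset I} {p : ℕ} (wt : I → ℤ) (w : ℤ) {f : Finset I → k}
    (hf : f ∈ forms k T p) : weightPart wt w f ∈ forms k T p := by
  intro S hS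
  refine hf S fun h => hS ?_
  simp [weightPart_apply, h]

theorem eq_zero_of_weightPart_eq_zero (wt : I → ℤ) {f : Finset I → k}
    (h : ∀ w, weightPart wt w f = 0) : f = 0 := by
  ext S
  have := congrFun (h (∑ v ∈ S, wt v)) S
  simpa [weightPart_apply] using this

theorem weightPart_eq_zero_of_neg {wt : I → ℤ} (hwt : ∀ v, 0 ≤ wt v) {w : ℤ} (hw : w < 0)
    (f : Finset I → k) : weightPart wt w f = 0 := by
  ext S
  have := Finset.sum_nonneg (s := S) fun v _ => hwt v
  rw [weightPart_apply, if_neg (by omega)]; rfl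

end Fock

section Blocks

open Finset.HasAntidiagonal (antidiagonal mem_antidiagonal)

/-- Monomials `x^i y^* z^j w^*` of a fixed bidegree are indexed by the pairs `(i, j)`. -/
abbrev Cell : Type := ℕ ×ₗ ℕ

/-- The pair `(i, j)`, the `j`-th cell of the block `i`. -/
def cell (i j : ℕ) : Cell := toLex (i, j)

theorem cell_inj {i j i' j' : ℕ} : cell i j = cell i' j' ↔ i = i' ∧ j = j' := by
  simp [cell]

theorem cell_ofLex (v : Cell) : cell (ofLex v).1 (ofLex v).2 = v := rfl

/-- The cells `(i, j)` with `i ≤ a` and `j ≤ n i`. -/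
def cellsBelow (a : ℕ) (n : ℕ → ℕ) : Finset Cell :=
  ((Finset.range (a + 1)).sigma fun i => Finset.range (n i + 1)).map
    ⟨fun q => cell q.1 q.2, by
      rintro ⟨i, j⟩ ⟨i', j'⟩ h
      obtain ⟨rfl, rfl⟩ := cell_inj.1 h
      rfl⟩

theorem cell_mem_cellsBelow {a : ℕ} {n : ℕ → ℕ} {i j : ℕ} :
    cell i j ∈ cellsBelow a n ↔ i ≤ a ∧ j ≤ n i := by
  unfold cellsBelow
  rw [Finset.mem_map]
  constructor
  · rintro ⟨⟨i', j'⟩, h, h'⟩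
    obtain ⟨rfl, rfl⟩ := cell_inj.1 h'
    simpa [Nat.lt_succ_iff] using h
  · rintro ⟨h1, h2⟩
    exact ⟨⟨i, j⟩, by simp; omega, rfl⟩

theorem card_cellsBelow (a : ℕ) (n : ℕ → ℕ) :
    (cellsBelow a n).card = ∑ i ∈ Finset.range (a + 1), (n i + 1) := by
  simp [cellsBelow]

variable {k : Type*} [Field k]

/-- The generating series `∑ j, contr (cell l j) t ^ j`, multiplied with the series whose
coefficients are the forms `e j`. -/
def blockOp (l : ℕ) : (ℕ → Finset Cell → k) →ₗ[k] (ℕ → Finset Cell → k) where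
  toFun e s := ∑ q ∈ antidiagonal s, contr (cell l q.1) (e q.2)
  map_add' e f := by ext1 s; simp [Finset.sum_add_distrib]
  map_smul' c e := by ext1 s; simp [Finset.smul_sum]

theorem blockOp_apply (l : ℕ) (e : ℕ → Finset Cell → k) (s : ℕ) :
    blockOp l e s = ∑ q ∈ antidiagonal s, contr (cell l q.1) (e q.2) := rfl

theorem sum_antidiagonal_antidiagonal {M : Type*} [AddCommMonoid M] (F : ℕ → ℕ → ℕ → M) (s : ℕ) :
    ∑ q ∈ antidiagonal s, ∑ r ∈ antidiagonal q.2, F q.1 r.1 r.2 =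
      ∑ q ∈ antidiagonal s, ∑ r ∈ antidiagonal q.1, F r.1 r.2 q.2 := by
  rw [Finset.sum_sigma', Finset.sum_sigma']
  refine Finset.sum_nbij' (fun x => ⟨(x.1.1 + x.2.1, x.2.2), (x.1.1, x.2.1)⟩)
    (fun x => ⟨(x.2.1, x.2.2 + x.1.2), (x.2.2, x.1.2)⟩) ?_ ?_ ?_ ?_ ?_
  · rintro ⟨⟨u, v⟩, ⟨w, x⟩⟩ h
    simp only [Finset.mem_sigma, mem_antidiagonal] at h ⊢
    exact ⟨by omega, trivial⟩
  · rintro ⟨⟨u, v⟩, ⟨w, x⟩⟩ h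
    simp only [Finset.mem_sigma, mem_antidiagonal] at h ⊢
    exact ⟨by omega, trivial⟩
  · rintro ⟨⟨u, v⟩, ⟨w, x⟩⟩ h
    simp only [Finset.mem_sigma, mem_antidiagonal] at h ⊢
    obtain ⟨h1, rfl⟩ := h
    rfl
  · rintro ⟨⟨u, v⟩, ⟨w, x⟩⟩ h
    simp only [Finset.mem_sigma, mem_antidiagonal] at h ⊢
    obtain ⟨h1, rfl⟩ := h
    rfl
  · rintro ⟨⟨u, v⟩, ⟨w, x⟩⟩ h
    rfl

theorem blockOp_blockOp_apply (l m : ℕ) (e : ℕ → Finset Cell → k) (s : ℕ) :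
    blockOp l (blockOp m e) s = ∑ q ∈ antidiagonal s, ∑ r ∈ antidiagonal q.1,
      contr (cell l r.1) (contr (cell m r.2) (e q.2)) := by
  simp only [blockOp_apply, map_sum]
  exact sum_antidiagonal_antidiagonal
    (fun u v w => contr (cell l u) (contr (cell m v) (e w))) s

theorem blockOp_blockOp_add (l m : ℕ) (e : ℕ → Finset Cell → k) :
    blockOp l (blockOp m e) + blockOp m (blockOp l e) = 0 := by
  ext1 s
  rw [Pi.add_apply, blockOp_blockOp_apply, blockOp_blockOp_apply, ← Finset.sum_add_distrib]
  refine Finset.sum_eq_zero fun q _ => ?_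
  rw [← Finset.Nat.sum_antidiagonal_swap (n := q.1)
    (f := fun r => contr (cell m r.1) (contr (cell l r.2) (e q.2))), ← Finset.sum_add_distrib]
  exact Finset.sum_eq_zero fun r _ => contr_contr_add _ _ _

theorem blockOp_blockOp_self (l : ℕ) (e : ℕ → Finset Cell → k) :
    blockOp l (blockOp l e) = 0 := by
  ext1 s
  rw [blockOp_blockOp_apply]
  refine Finset.sum_eq_zero fun q _ => ?_
  refine Finset.sum_involution (fun r _ => r.swap) (fun r _ => contr_contr_add _ _ _) ?_ ?_ ?_
  · rintro ⟨u, v⟩ _ h h'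
    obtain rfl : v = u := by simpa using congrArg Prod.fst h'
    exact h (contr_contr_self _ _)
  · intro r hr
    rw [mem_antidiagonal] at hr ⊢
    simpa [add_comm] using hr
  · intro r _
    simp

theorem contr_blockOp (v : Cell) (l : ℕ) (e : ℕ → Finset Cell → k) (s : ℕ) :
    contr v (blockOp l e s) = -blockOp l (fun t => contr v (e t)) s := by
  rw [blockOp_apply, blockOp_apply, map_sum, ← Finset.sum_neg_distrib]
  exact Finset.sum_congr rfl fun q _ => eq_neg_of_add_eq_zero_left (contr_contr_add _ _ _)

theorem blockOp_contr_eq_zero (v : Cell) {l : ℕ} {e : ℕ → Finset Cell → k}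
    (h : blockOp l e = 0) : blockOp l (fun t => contr v (e t)) = 0 := by
  ext1 s
  have := contr_blockOp v l e s
  rw [h, Pi.zero_apply, map_zero] at this
  exact neg_eq_zero.1 this.symm

theorem blockOp_mem_forms {T : Finset Cell} {p : ℕ} {e : ℕ → Finset Cell → k}
    (he : ∀ t, e t ∈ forms k T (p + 1)) (l s : ℕ) : blockOp l e s ∈ forms k T p := by
  rw [blockOp_apply]
  exact Submodule.sum_mem _ fun _ _ => contr_mem_forms' _ (he _)

/-- The square of the block number of a cell. -/
def cellWeight (v : Cell) : ℤ := ((ofLex v).1 : ℤ) ^ 2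

theorem weightPart_blockOp (w : ℤ) (l : ℕ) (e : ℕ → Finset Cell → k) (s : ℕ) :
    weightPart cellWeight w (blockOp l e s) =
      blockOp l (fun t => weightPart cellWeight (w + (l : ℤ) ^ 2) (e t)) s := by
  rw [blockOp_apply, blockOp_apply, map_sum]
  exact Finset.sum_congr rfl fun q _ => (contr_weightPart cellWeight w _ _).symm

/-- A sequence of forms of large degree and bounded length which is annihilated by the operators
of the blocks in `L` vanishes. -/
theorem eq_zero_of_blockOp_eq_zero (L : Finset ℕ) (T : Finset Cell) (m P : ℕ)
    (e : ℕ → Finset Cell → k) (heT : ∀ s, e s ∈ forms k T P) (hem : ∀ s, m ≤ s → e s = 0)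
    (heL : ∀ l ∈ L, blockOp l e = 0)
    (hP : m + (T.filter fun v => (ofLex v).1 ∉ L).card ≤ P) : e = 0 := by
  induction hN : T.card generalizing T m P e with
  | zero =>
    rw [Finset.card_eq_zero] at hN
    subst hN
    rcases m with _ | m
    · exact funext fun s => hem s (Nat.zero_le s)
    · obtain ⟨P, rfl⟩ : ∃ Q, P = Q + 1 := ⟨P - 1, by omega⟩
      exact funext fun s => eq_zero_of_forms_empty (heT s)
  | succ N ih =>
    rcases m with _ | m
    · exact funext fun s => hem s (Nat.zero_le s)
    obtain ⟨P, rfl⟩ : ∃ Q, P = Q + 1 := ⟨P - 1, by omega⟩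
    have key : ∃ v ∈ T, ∀ s, contr v (e s) = 0 := by
      by_cases hv : ∃ v ∈ T, (ofLex v).1 ∉ L
      · obtain ⟨v, hvT, hvL⟩ := hv
        have hvf : v ∈ T.filter fun v => (ofLex v).1 ∉ L := by simp [hvT, hvL]
        refine ⟨v, hvT, congrFun (ih (T.erase v) (m + 1) P (fun t => contr v (e t))
          (fun s => contr_mem_forms v (heT s)) (fun s hs => by rw [hem s hs, map_zero])
          (fun l hl => blockOp_contr_eq_zero v (heL l hl)) ?_
          (by rw [Finset.card_erase_of_mem hvT]; omega))⟩
        rw [Finset.filter_erase, Finset.card_erase_of_mem hvf]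
        have := Finset.card_pos.2 ⟨v, hvf⟩
        omega
      · push Not at hv
        have hne : T.Nonempty := Finset.card_pos.1 (by omega)
        have hmT := T.max'_mem hne
        refine ⟨T.max' hne, hmT, congrFun (ih (T.erase (T.max' hne)) m P
          (fun t => contr (T.max' hne) (e t))
          (fun s => contr_mem_forms _ (heT s)) ?_
          (fun l hl => blockOp_contr_eq_zero _ (heL l hl)) ?_
          (by rw [Finset.card_erase_of_mem hmT]; omega))⟩
        · intro s hs
          rcases Nat.eq_or_lt_of_le hs with rfl | hs'
          · set v := T.max' hne with hvdef
            have h := congrFun (heL _ (hv v hmT)) (m + (ofLex v).2)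
            rw [blockOp_apply, Finset.sum_eq_single ((ofLex v).2, m)] at h
            · simpa [cell_ofLex] using h
            · rintro ⟨u, t⟩ hut hne'
              rw [mem_antidiagonal] at hut
              simp only [ne_eq, Prod.mk.injEq, not_and] at hne' hut ⊢
              rcases lt_trichotomy t m with ht | rfl | ht
              · refine contr_eq_zero_of_notMem (heT t) fun hmem => ?_
                have hle := Prod.Lex.le_iff.1 (T.le_max' _ hmem)
                change (ofLex v).1 < (ofLex v).1 ∨
                  (ofLex v).1 = (ofLex v).1 ∧ u ≤ (ofLex v).2 at hle
                omega
              · omega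
              · rw [hem t ht, map_zero]
            · intro hcon
              exact absurd (mem_antidiagonal.2 (by simp [add_comm])) hcon
          · simp only [hem s hs', map_zero]
        · have : ((T.erase (T.max' hne)).filter fun v => (ofLex v).1 ∉ L).card ≤
            (T.filter fun v => (ofLex v).1 ∉ L).card :=
            Finset.card_le_card (Finset.filter_subset_filter _ (Finset.erase_subset _ _))
          omega
    obtain ⟨v, hvT, hv⟩ := key
    refine ih (T.erase v) (m + 1) (P + 1) e (fun s => mem_forms_erase (heT s) (hv s)) hem heL ?_
      (by rw [Finset.card_erase_of_mem hvT]; omega)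
    have : ((T.erase v).filter fun v => (ofLex v).1 ∉ L).card ≤
        (T.filter fun v => (ofLex v).1 ∉ L).card :=
      Finset.card_le_card (Finset.filter_subset_filter _ (Finset.erase_subset _ _))
    omega

/-- The relation between the blocks `i` and `j`. -/
def pairRel (ω : ℕ → ℕ → Finset Cell → k) (i j : ℕ) : ℕ → Finset Cell → k :=
  if i = j then blockOp i (ω i) else blockOp i (ω j) + blockOp j (ω i)

theorem pairRel_self (ω : ℕ → ℕ → Finset Cell → k) (i : ℕ) :
    pairRel ω i i = blockOp i (ω i) := if_pos rfl

theorem pairRel_of_ne (ω : ℕ → ℕ → Finset Cell → k) {i j : ℕ} (h : i ≠ j) :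
    pairRel ω i j = blockOp i (ω j) + blockOp j (ω i) := if_neg h

theorem pairRel_comm (ω : ℕ → ℕ → Finset Cell → k) (i j : ℕ) :
    pairRel ω i j = pairRel ω j i := by
  rcases eq_or_ne i j with rfl | h
  · rfl
  · rw [pairRel_of_ne ω h, pairRel_of_ne ω h.symm, add_comm]

theorem sum_blockOp_eq_sum_pairRel (ω : ℕ → ℕ → Finset Cell → k) (r : ℕ) :
    ∑ q ∈ antidiagonal r, blockOp q.1 (ω q.2) =
      ∑ q ∈ (antidiagonal r).filter (fun q => q.1 ≤ q.2), pairRel ω q.1 q.2 := by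
  rw [← Finset.sum_filter_add_sum_filter_not (antidiagonal r) (fun q => q.1 ≤ q.2)]
  have h1 : ∑ q ∈ (antidiagonal r).filter (fun q => ¬ q.1 ≤ q.2), blockOp q.1 (ω q.2) =
      ∑ q ∈ (antidiagonal r).filter (fun q => q.1 ≤ q.2),
        if q.1 = q.2 then 0 else blockOp q.2 (ω q.1) := by
    rw [← Finset.sum_filter_add_sum_filter_not ((antidiagonal r).filter (fun q => q.1 ≤ q.2))
      (fun q => q.1 = q.2)]
    rw [Finset.sum_eq_zero (fun q hq => if_pos (Finset.mem_filter.1 hq).2), zero_add]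
    refine Finset.sum_nbij' (fun q => q.swap) (fun q => q.swap) ?_ ?_ (by simp) (by simp) ?_
    · intro q hq
      simp only [Finset.mem_filter, mem_antidiagonal, Prod.fst_swap, Prod.snd_swap] at hq ⊢
      omega
    · intro q hq
      simp only [Finset.mem_filter, mem_antidiagonal, Prod.fst_swap, Prod.snd_swap] at hq ⊢
      omega
    · intro q hq
      simp only [Finset.mem_filter, mem_antidiagonal] at hq
      rw [if_neg (by simp only [Prod.fst_swap, Prod.snd_swap]; omega)]
      rfl
  rw [h1, ← Finset.sum_add_distrib]
  refine Finset.sum_congr rfl fun q _ => ?_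
  unfold pairRel
  split_ifs with h
  · rw [h, add_zero]
  · rfl

theorem blockOp_pairRel_self (ω : ℕ → ℕ → Finset Cell → k) (i : ℕ) :
    blockOp i (pairRel ω i i) = 0 := by
  rw [pairRel_self, blockOp_blockOp_self]

theorem blockOp_pairRel_add (ω : ℕ → ℕ → Finset Cell → k) {i l : ℕ} (h : i ≠ l) :
    blockOp l (pairRel ω i i) + blockOp i (pairRel ω i l) = 0 := by
  rw [pairRel_self, pairRel_of_ne ω h, map_add, blockOp_blockOp_self, zero_add,
    blockOp_blockOp_add]

theorem blockOp_pairRel_add_add (ω : ℕ → ℕ → Finset Cell → k) {i j l : ℕ} (hij : i ≠ j)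
    (hjl : j ≠ l) (hil : i ≠ l) :
    blockOp l (pairRel ω i j) + blockOp i (pairRel ω j l) + blockOp j (pairRel ω i l) = 0 := by
  rw [pairRel_of_ne ω hij, pairRel_of_ne ω hjl, pairRel_of_ne ω hil, map_add, map_add, map_add]
  have h1 := blockOp_blockOp_add l i (ω j)
  have h2 := blockOp_blockOp_add l j (ω i)
  have h3 := blockOp_blockOp_add i j (ω l)
  linear_combination (exp := 1) h1 + h2 + h3

end Blocks

section Relations

open Finset.HasAntidiagonal (antidiagonal mem_antidiagonal)

variable {k : Type*} [Field k]

theorem blockOp_eq_zero_of_lt {a p : ℕ} {n : ℕ → ℕ} {e : ℕ → Finset Cell → k}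
    (he : ∀ t, e t ∈ forms k (cellsBelow a n) p) {l : ℕ} (hl : a < l) : blockOp l e = 0 := by
  ext1 s
  rw [blockOp_apply]
  refine Finset.sum_eq_zero fun q _ => contr_eq_zero_of_notMem (he _) fun h => ?_
  have := (cell_mem_cellsBelow.1 h).1
  omega

theorem pairRel_eq_zero_of_lt {a p : ℕ} {n : ℕ → ℕ} {ω : ℕ → ℕ → Finset Cell → k}
    (hω : ∀ i j, ω i j ∈ forms k (cellsBelow a n) p) (hωa : ∀ i j, a < i → ω i j = 0)
    {i j : ℕ} (hj : a < j) : pairRel ω i j = 0 := by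
  have h1 : ω j = 0 := funext fun t => hωa j t hj
  have h2 := fun i => blockOp_eq_zero_of_lt (hω i) hj
  unfold pairRel
  split_ifs with h
  · rw [h, h2]
  · rw [h1, map_zero, h2, zero_add]

theorem blockOp_apply_eq_zero {a b p l s : ℕ} {e : ℕ → Finset Cell → k}
    (he : ∀ t, e t ∈ forms k (cellsBelow a fun _ => b) p) (heb : ∀ t, b < t → e t = 0)
    (hs : 2 * b < s) : blockOp l e s = 0 := by
  rw [blockOp_apply]
  refine Finset.sum_eq_zero fun q hq => ?_
  rw [mem_antidiagonal] at hq
  by_cases h : b < q.2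
  · rw [heb _ h, map_zero]
  · refine contr_eq_zero_of_notMem (he _) fun h' => ?_
    have := (cell_mem_cellsBelow.1 h').2
    omega

theorem pairRel_apply_eq_zero {a b p : ℕ} {ω : ℕ → ℕ → Finset Cell → k}
    (hω : ∀ i j, ω i j ∈ forms k (cellsBelow a fun _ => b) p)
    (hωb : ∀ i j, b < j → ω i j = 0) {i j s : ℕ} (hs : 2 * b < s) : pairRel ω i j s = 0 := by
  unfold pairRel
  split_ifs with h
  · exact blockOp_apply_eq_zero (hω i) (hωb i) hs
  · rw [Pi.add_apply, blockOp_apply_eq_zero (hω i) (hωb i) hs,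
      blockOp_apply_eq_zero (hω j) (hωb j) hs, zero_add]

theorem pairRel_mem_forms {T : Finset Cell} {p : ℕ} {ω : ℕ → ℕ → Finset Cell → k}
    (hω : ∀ i j, ω i j ∈ forms k T (p + 1)) (i j s : ℕ) : pairRel ω i j s ∈ forms k T p := by
  unfold pairRel
  split_ifs with h
  · exact blockOp_mem_forms (hω i) _ _
  · exact add_mem (blockOp_mem_forms (hω j) _ _) (blockOp_mem_forms (hω i) _ _)

theorem card_filter_block (a b j : ℕ) :
    ((cellsBelow a fun _ => b).filter
      fun v => (ofLex v).1 ∉ insert 0 (Finset.Icc j a)).card ≤ (j - 1) * (b + 1) := by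
  have hsub : ((cellsBelow a fun _ => b).filter
      fun v => (ofLex v).1 ∉ insert 0 (Finset.Icc j a)) ⊆
      (Finset.Ico 1 j ×ˢ Finset.range (b + 1)).image fun q => cell q.1 q.2 := by
    intro v hv
    rw [Finset.mem_filter, ← cell_ofLex v, cell_mem_cellsBelow] at hv
    obtain ⟨⟨h1, h2⟩, h3⟩ := hv
    change (ofLex v).1 ∉ _ at h3
    simp only [Finset.mem_insert, Finset.mem_Icc, not_or, not_and] at h3
    refine Finset.mem_image.2 ⟨((ofLex v).1, (ofLex v).2), ?_, cell_ofLex v⟩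
    simp only [Finset.mem_product, Finset.mem_Ico, Finset.mem_range]
    omega
  refine (Finset.card_le_card hsub).trans (Finset.card_image_le.trans ?_)
  simp

/-- In large degree, the relations summed along the antidiagonals `i + j = r` already imply
all the relations between pairs of blocks. -/
theorem pairRel_eq_zero_of_sum {a b n : ℕ} (hn : a * b + a ≤ n + 1)
    {ω : ℕ → ℕ → Finset Cell → k}
    (hω : ∀ i j, ω i j ∈ forms k (cellsBelow a fun _ => b) (n + 1))
    (hωa : ∀ i j, a < i → ω i j = 0) (hωb : ∀ i j, b < j → ω i j = 0)
    (hrel : ∀ r, ∑ q ∈ antidiagonal r, blockOp q.1 (ω q.2) = 0) (i j : ℕ) :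
    pairRel ω i j = 0 := by
  have main : ∀ M : ℕ, ∀ i j s : ℕ, ∀ w : ℤ, w + (i : ℤ) ^ 2 + (j : ℤ) ^ 2 = M →
      weightPart cellWeight w (pairRel ω i j s) = 0 := by
    intro M
    induction M using Nat.strong_induction_on with
    | _ M ih =>
    have hneg : ∀ w : ℤ, w < 0 → ∀ f : Finset Cell → k, weightPart cellWeight w f = 0 :=
      fun w hw f => weightPart_eq_zero_of_neg (fun v => sq_nonneg _) hw f
    have hlower : ∀ i j s : ℕ, ∀ w : ℤ, w + (i : ℤ) ^ 2 + (j : ℤ) ^ 2 < M →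
        weightPart cellWeight w (pairRel ω i j s) = 0 := by
      intro i j s w hw
      by_cases hw0 : w < 0
      · exact hneg w hw0 _
      · have h0 : 0 ≤ w + (i : ℤ) ^ 2 + (j : ℤ) ^ 2 := by nlinarith [sq_nonneg (i : ℤ), sq_nonneg (j : ℤ)]
        exact ih (w + (i : ℤ) ^ 2 + (j : ℤ) ^ 2).toNat (by omega) i j s w (by omega)
    have hbd : ∀ i j s : ℕ, ∀ w : ℤ, i ≤ j → (i = 0 ∨ a ≤ j) →
        w + (i : ℤ) ^ 2 + (j : ℤ) ^ 2 = M → weightPart cellWeight w (pairRel ω i j s) = 0 := by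
      intro i j s w hij hb hw
      by_cases hja : a < j
      · rw [pairRel_eq_zero_of_lt hω hωa hja, Pi.zero_apply, map_zero]
      have h := congrFun (hrel (i + j)) s
      rw [sum_blockOp_eq_sum_pairRel, Finset.sum_apply] at h
      have h' := congrArg (weightPart cellWeight w) h
      rw [map_sum, Pi.zero_apply, map_zero, Finset.sum_eq_single (i, j)] at h'
      · exact h'
      · rintro ⟨i', j'⟩ hq hne
        simp only [Finset.mem_filter, mem_antidiagonal, ne_eq, Prod.mk.injEq, not_and] at hq hne
        obtain ⟨hsum, hle⟩ := hq
        dsimp only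
        by_cases hja' : a < j'
        · rw [pairRel_eq_zero_of_lt hω hωa hja', Pi.zero_apply, map_zero]
        refine hlower i' j' s w ?_
        have hi : i < i' := by
          rcases lt_trichotomy i i' with h1 | h1 | h1
          · exact h1
          · omega
          · omega
        have hj : j' < j := by omega
        have hjz : (j : ℤ) = i' + j' - i := by omega
        have hiz : (i : ℤ) < i' := by omega
        have hijz : (i : ℤ) < j' := by omega
        rw [hjz] at hw
        nlinarith [mul_pos (sub_pos.2 hiz) (sub_pos.2 hijz)]
      · intro hcon
        exact absurd (by simpa using hij) hcon
    have hvanish : ∀ x i : ℕ, a - i = x → ∀ y j : ℕ, a - j = y → ∀ s : ℕ, ∀ w : ℤ, i ≤ j →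
        w + (i : ℤ) ^ 2 + (j : ℤ) ^ 2 = M → weightPart cellWeight w (pairRel ω i j s) = 0 := by
      intro x
      induction x using Nat.strong_induction_on with
      | _ x ihx =>
      intro i hx y
      induction y using Nat.strong_induction_on with
      | _ y ihy =>
      intro j hy s w hij hw
      by_cases hb : i = 0 ∨ a ≤ j
      · exact hbd i j s w hij hb hw
      push Not at hb
      obtain ⟨hi0, hja⟩ := hb
      have later : ∀ i' j' s : ℕ, ∀ w : ℤ, i' ≤ j' → (i < i' ∨ i' = i ∧ j < j' ∨ i' = 0) →
          w + (i' : ℤ) ^ 2 + (j' : ℤ) ^ 2 = M →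
          weightPart cellWeight w (pairRel ω i' j' s) = 0 := by
        intro i' j' s w hij' hlt hw'
        by_cases hb : i' = 0 ∨ a ≤ j'
        · exact hbd i' j' s w hij' hb hw'
        push Not at hb
        rcases hlt with h1 | ⟨rfl, h1⟩ | h1
        · exact ihx (a - i') (by omega) i' rfl (a - j') j' rfl s w hij' hw'
        · exact ihy (a - j') (by omega) j' rfl s w hij' hw'
        · exact absurd h1 hb.1
      have hzero : ∀ i' j' : ℕ, ∀ l : ℕ, ∀ w : ℤ,
          (∀ s, weightPart cellWeight (w + (l : ℤ) ^ 2) (pairRel ω i' j' s) = 0) →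
          ∀ s, weightPart cellWeight w (blockOp l (pairRel ω i' j') s) = 0 := by
        intro i' j' l w h s
        rw [weightPart_blockOp, show (fun t => weightPart cellWeight (w + (l : ℤ) ^ 2)
          (pairRel ω i' j' t)) = 0 from funext h, map_zero, Pi.zero_apply]
      have hL : ∀ l ∈ insert 0 (Finset.Icc j a),
          blockOp l (fun t => weightPart cellWeight w (pairRel ω i j t)) = 0 := by
        intro l hl
        ext1 s
        have hl' : l = 0 ∨ j ≤ l ∧ l ≤ a := by simpa using hl
        have e1 := weightPart_blockOp (w - (l : ℤ) ^ 2) l (pairRel ω i j) s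
        rw [sub_add_cancel] at e1
        rw [← e1, Pi.zero_apply]
        rcases eq_or_ne i j with rfl | hne
        · rcases eq_or_ne i l with rfl | hil
          · rw [blockOp_pairRel_self, Pi.zero_apply, map_zero]
          · have e2 := congrArg (weightPart cellWeight (w - (l : ℤ) ^ 2))
              (congrFun (blockOp_pairRel_add ω hil) s)
            rw [Pi.add_apply, map_add, Pi.zero_apply, map_zero, hzero i l i, add_zero] at e2
            · exact e2
            · intro s
              rcases hl' with rfl | hl'
              · rw [pairRel_comm]
                exact later 0 i s _ (by omega) (by omega) (by linarith)
              · exact later i l s _ (by omega) (by omega) (by linarith)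
        · rcases eq_or_ne j l with rfl | hjl
          · have e2 := congrArg (weightPart cellWeight (w - (j : ℤ) ^ 2))
              (congrFun (blockOp_pairRel_add ω hne.symm) s)
            rw [Pi.add_apply, map_add, Pi.zero_apply, map_zero, hzero j j i, zero_add,
              pairRel_comm] at e2
            · exact e2
            · intro s
              exact later j j s _ le_rfl (by omega) (by linarith)
          · have hil : i ≠ l := by omega
            have e2 := congrArg (weightPart cellWeight (w - (l : ℤ) ^ 2))
              (congrFun (blockOp_pairRel_add_add ω hne hjl hil) s)
            rw [Pi.add_apply, Pi.add_apply, map_add, map_add, Pi.zero_apply, map_zero,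
              hzero j l i, hzero i l j, add_zero, add_zero] at e2
            · exact e2
            · intro s
              rcases hl' with rfl | hl'
              · rw [pairRel_comm]
                exact later 0 i s _ (by omega) (by omega) (by linarith)
              · exact later i l s _ (by omega) (by omega) (by linarith)
            · intro s
              rcases hl' with rfl | hl'
              · rw [pairRel_comm]
                exact later 0 j s _ (by omega) (by omega) (by linarith)
              · exact later j l s _ (by omega) (by omega) (by linarith)
      refine congrFun (eq_zero_of_blockOp_eq_zero (insert 0 (Finset.Icc j a))
        (cellsBelow a fun _ => b) (2 * b + 1) n
        (fun t => weightPart cellWeight w (pairRel ω i j t))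
        (fun t => weightPart_mem_forms _ _ (pairRel_mem_forms hω i j t))
        (fun t ht => by
          rw [pairRel_apply_eq_zero hω hωb (by omega), map_zero]) hL ?_) s
      have hcard := card_filter_block a b j
      obtain ⟨c, rfl⟩ : ∃ c, a = c + 2 := ⟨a - 2, by omega⟩
      have h1 : (j - 1) * (b + 1) ≤ c * (b + 1) := Nat.mul_le_mul_right _ (by omega)
      nlinarith
    intro i j s w hw
    rcases le_total i j with hij | hij
    · exact hvanish _ i rfl _ j rfl s w hij hw
    · rw [pairRel_comm]
      exact hvanish _ j rfl _ i rfl s w hij (by linarith)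
  ext1 s
  refine eq_zero_of_weightPart_eq_zero cellWeight fun w => ?_
  by_cases hw : w < 0
  · exact weightPart_eq_zero_of_neg (fun v => sq_nonneg _) hw _
  · have h0 : 0 ≤ w + (i : ℤ) ^ 2 + (j : ℤ) ^ 2 := by nlinarith [sq_nonneg (i : ℤ), sq_nonneg (j : ℤ)]
    exact main (w + (i : ℤ) ^ 2 + (j : ℤ) ^ 2).toNat i j s w (by omega)

end Relations

section Cycles

open Finset.HasAntidiagonal (antidiagonal mem_antidiagonal)

variable {k : Type*} [Field k]

theorem Submodule.finrank_map_add_finrank_inf_ker {V W : Type*} [AddCommGroup V] [Module k V]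
    [AddCommGroup W] [Module k W] (f : V →ₗ[k] W) (Z : Submodule k V) [Module.Finite k Z] :
    Module.finrank k (Z.map f) + Module.finrank k (Z ⊓ LinearMap.ker f : Submodule k V) =
      Module.finrank k Z := by
  rw [← LinearMap.finrank_range_add_finrank_ker (f.domRestrict Z), LinearMap.range_domRestrict,
    LinearMap.ker_domRestrict, ← Submodule.map_comap_subtype, Submodule.finrank_map_subtype_eq]

theorem pairRel_add (ω ω' : ℕ → ℕ → Finset Cell → k) (i j : ℕ) :
    pairRel (ω + ω') i j = pairRel ω i j + pairRel ω' i j := by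
  unfold pairRel
  split_ifs with h
  · exact map_add _ _ _
  · rw [Pi.add_apply, Pi.add_apply, map_add, map_add]
    abel

theorem pairRel_comp (F : (ℕ → Finset Cell → k) →ₗ[k] (ℕ → Finset Cell → k)) (c : k)
    (hF : ∀ l e, blockOp l (F e) = c • F (blockOp l e)) (ω : ℕ → ℕ → Finset Cell → k) (i j : ℕ) :
    pairRel (fun i => F (ω i)) i j = c • F (pairRel ω i j) := by
  unfold pairRel
  split_ifs with h
  · exact hF _ _
  · rw [hF, hF, map_add, smul_add]

/-- Families of forms of degree `p` in the cells below `n`, supported in the columns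
`c ≤ j ≤ n i` and satisfying all relations between pairs of blocks. -/
def blockCycles (k : Type*) [Field k] (a : ℕ) (n : ℕ → ℕ) (p c : ℕ) :
    Submodule k (ℕ → ℕ → Finset Cell → k) where
  carrier := {ω | (∀ i j, ω i j ∈ forms k (cellsBelow a n) p) ∧
    (∀ i j, ¬ (i ≤ a ∧ c ≤ j ∧ j ≤ n i) → ω i j = 0) ∧ ∀ i j, pairRel ω i j = 0}
  add_mem' := by
    rintro ω ω' ⟨h1, h2, h3⟩ ⟨h1', h2', h3'⟩
    exact ⟨fun i j => add_mem (h1 i j) (h1' i j),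
      fun i j h => by rw [Pi.add_apply, Pi.add_apply, h2 i j h, h2' i j h, add_zero],
      fun i j => by rw [pairRel_add, h3, h3', add_zero]⟩
  zero_mem' := by
    refine ⟨fun i j => zero_mem _, fun i j _ => rfl, fun i j => ?_⟩
    unfold pairRel
    simp
  smul_mem' := by
    rintro r ω ⟨h1, h2, h3⟩
    refine ⟨fun i j => Submodule.smul_mem _ r (h1 i j),
      fun i j h => by rw [Pi.smul_apply, Pi.smul_apply, h2 i j h, smul_zero], fun i j => ?_⟩
    have := pairRel_comp (r • LinearMap.id) 1 (fun l e => by simp) ω i j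
    rw [h3, map_zero, smul_zero] at this
    exact this

theorem mem_blockCycles {a : ℕ} {n : ℕ → ℕ} {p c : ℕ} {ω : ℕ → ℕ → Finset Cell → k} :
    ω ∈ blockCycles k a n p c ↔ (∀ i j, ω i j ∈ forms k (cellsBelow a n) p) ∧
      (∀ i j, ¬ (i ≤ a ∧ c ≤ j ∧ j ≤ n i) → ω i j = 0) ∧ ∀ i j, pairRel ω i j = 0 := Iff.rfl

instance (a : ℕ) (n : ℕ → ℕ) (p c : ℕ) : Module.Finite k (blockCycles k a n p c) := by
  let f : blockCycles k a n p c →ₗ[k]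
      ((i : Fin (a + 1)) → (j : Fin (n i + 1)) → forms k (cellsBelow a n) p) :=
    { toFun := fun ω i j => ⟨ω.1 i j, ω.2.1 i j⟩
      map_add' := fun _ _ => rfl
      map_smul' := fun _ _ => rfl }
  refine Module.Finite.of_injective f fun ω ω' h => ?_
  ext1
  ext1 i
  ext1 j
  by_cases hij : i ≤ a ∧ c ≤ j ∧ j ≤ n i
  · exact congrArg Subtype.val (congrFun (congrFun h ⟨i, by omega⟩) ⟨j, by simp; omega⟩)
  · rw [ω.2.2.1 i j hij, ω'.2.2.1 i j hij]

/-- Multiplication of a series by `t ^ m`. -/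
def shiftBy (m : ℕ) : (ℕ → Finset Cell → k) →ₗ[k] (ℕ → Finset Cell → k) where
  toFun e s := if m ≤ s then e (s - m) else 0
  map_add' e f := by ext1 s; by_cases h : m ≤ s <;> simp [h]
  map_smul' c e := by ext1 s; by_cases h : m ≤ s <;> simp [h]

theorem shiftBy_apply (m : ℕ) (e : ℕ → Finset Cell → k) (s : ℕ) :
    shiftBy m e s = if m ≤ s then e (s - m) else 0 := rfl

theorem shiftBy_one_shiftBy (m : ℕ) (e : ℕ → Finset Cell → k) :
    shiftBy 1 (shiftBy m e) = shiftBy (m + 1) e := by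
  ext1 s
  simp only [shiftBy_apply]
  by_cases h : m + 1 ≤ s
  · rw [if_pos (by omega), if_pos (by omega), if_pos h, Nat.sub_sub, Nat.add_comm 1 m]
  · rw [if_neg h]
    by_cases h' : 1 ≤ s
    · rw [if_pos h', if_neg (by omega)]
    · rw [if_neg h']

theorem blockOp_shiftBy_one (l : ℕ) (e : ℕ → Finset Cell → k) :
    blockOp l (shiftBy 1 e) = shiftBy 1 (blockOp l e) := by
  ext1 s
  rw [blockOp_apply, shiftBy_apply]
  rcases s with _ | s
  · simp [shiftBy_apply]
  · rw [Finset.Nat.sum_antidiagonal_succ']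
    simp [shiftBy_apply, blockOp_apply]

theorem blockOp_lmulBasis (l i N : ℕ) (e : ℕ → Finset Cell → k) :
    blockOp l ((lmulBasis (cell i N)).compLeft ℕ e) =
      -(lmulBasis (cell i N)).compLeft ℕ (blockOp l e) + if l = i then shiftBy N e else 0 := by
  ext1 s
  have h1 : ∀ q : ℕ × ℕ, contr (cell l q.1) (lmulBasis (cell i N) (e q.2)) =
      -lmulBasis (cell i N) (contr (cell l q.1) (e q.2)) +
        if l = i ∧ q.1 = N then e q.2 else 0 := by
    intro q
    split_ifs with h
    · obtain ⟨rfl, hq⟩ := h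
      rw [hq]
      exact eq_neg_add_of_add_eq (by rw [add_comm]; exact contr_lmulBasis_self_add _ _)
    · rw [add_zero]
      exact eq_neg_of_add_eq_zero_left (contr_lmulBasis_add (by rwa [ne_eq, cell_inj]) _)
  have h2 : ∑ q ∈ antidiagonal s, (if l = i ∧ q.1 = N then e q.2 else 0) =
      (if l = i then shiftBy N e else 0) s := by
    by_cases hl : l = i
    · simp only [hl, true_and, if_true, shiftBy_apply]
      by_cases hN : N ≤ s
      · rw [if_pos hN, Finset.sum_eq_single (N, s - N)]
        · simp
        · rintro ⟨u, t⟩ hq hne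
          rw [mem_antidiagonal] at hq
          refine if_neg fun h => hne ?_
          dsimp only at hq h
          rw [Prod.mk.injEq]
          omega
        · intro h
          exact absurd (mem_antidiagonal.2 (by dsimp only; omega)) h
      · rw [if_neg hN]
        refine Finset.sum_eq_zero fun q hq => if_neg ?_
        rw [mem_antidiagonal] at hq
        omega
    · simp [hl]
  rw [Pi.add_apply, Pi.neg_apply, ← h2, blockOp_apply, LinearMap.compLeft_apply,
    Function.comp_apply, blockOp_apply, map_sum, ← Finset.sum_neg_distrib,
    ← Finset.sum_add_distrib]
  exact Finset.sum_congr rfl fun q _ => h1 q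

/-- Multiplication of a series by the difference of `t` times the basis vector `(i, N)` and
the basis vector `(i, N + 1)`. -/
def raiseSeq (i N : ℕ) : (ℕ → Finset Cell → k) →ₗ[k] (ℕ → Finset Cell → k) :=
  -(lmulBasis (cell i (N + 1))).compLeft ℕ + shiftBy 1 ∘ₗ (lmulBasis (cell i N)).compLeft ℕ

theorem blockOp_raiseSeq (i N l : ℕ) (e : ℕ → Finset Cell → k) :
    blockOp l (raiseSeq i N e) = (-1 : k) • raiseSeq i N (blockOp l e) := by
  simp only [raiseSeq, LinearMap.add_apply, LinearMap.neg_apply, LinearMap.comp_apply, map_add,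
    map_neg, blockOp_shiftBy_one, blockOp_lmulBasis, neg_smul, one_smul]
  split_ifs with h
  · rw [shiftBy_one_shiftBy]
    abel
  · rw [map_zero]
    abel

/-- The family of all contractions of a form. -/
def gradForm : (Finset Cell → k) →ₗ[k] (ℕ → ℕ → Finset Cell → k) :=
  LinearMap.pi fun i => LinearMap.pi fun j => contr (cell i j)

theorem gradForm_apply (η : Finset Cell → k) (i j : ℕ) :
    gradForm η i j = contr (cell i j) η := rfl

theorem gradForm_eq_blockOp (η : Finset Cell → k) (i : ℕ) :
    gradForm η i = blockOp i (Pi.single 0 η) := by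
  ext1 s
  rw [blockOp_apply, Finset.sum_eq_single (s, 0)]
  · simp [gradForm_apply]
  · rintro ⟨u, t⟩ hq hne
    rw [mem_antidiagonal] at hq
    have : t ≠ 0 := by
      rintro rfl
      exact hne (by simpa using hq)
    simp [this]
  · intro h
    exact absurd (mem_antidiagonal.2 (by simp)) h

theorem pairRel_gradForm (η : Finset Cell → k) (i j : ℕ) : pairRel (gradForm η) i j = 0 := by
  unfold pairRel
  split_ifs with h
  · rw [gradForm_eq_blockOp, blockOp_blockOp_self]
  · rw [gradForm_eq_blockOp, gradForm_eq_blockOp, blockOp_blockOp_add]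

theorem blockOp_eq_lead {T : Finset Cell} {p l U t : ℕ} {e : ℕ → Finset Cell → k}
    (he : ∀ s, e s ∈ forms k T p) (hU : ∀ u, U < u → cell l u ∉ T) (ht : ∀ s, t < s → e s = 0) :
    blockOp l e (U + t) = contr (cell l U) (e t) := by
  rw [blockOp_apply, Finset.sum_eq_single (U, t)]
  · rintro ⟨u, s⟩ hq hne
    rw [mem_antidiagonal] at hq
    dsimp only at hq ⊢
    rcases lt_trichotomy t s with h | rfl | h
    · rw [ht s h, map_zero]
    · exact absurd (by rw [Prod.mk.injEq]; omega) hne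
    · exact contr_eq_zero_of_notMem (he s) (hU u (by omega))
  · intro h
    exact absurd (by simp) h

theorem blockOp_eq_zero_of_lead_lt {T : Finset Cell} {p l U t s : ℕ} {e : ℕ → Finset Cell → k}
    (he : ∀ s, e s ∈ forms k T p) (hU : ∀ u, U < u → cell l u ∉ T) (ht : ∀ s, t < s → e s = 0)
    (hs : U + t < s) : blockOp l e s = 0 := by
  rw [blockOp_apply]
  refine Finset.sum_eq_zero fun q hq => ?_
  rw [mem_antidiagonal] at hq
  by_cases h : t < q.2
  · rw [ht _ h, map_zero]
  · exact contr_eq_zero_of_notMem (he _) (hU _ (by omega))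

theorem cell_notMem_cellsBelow {a : ℕ} {n : ℕ → ℕ} {i : ℕ} (u : ℕ) (hu : n i < u) :
    cell i u ∉ cellsBelow a n := fun h => by
  have := (cell_mem_cellsBelow.1 h).2
  omega

theorem contr_lead_self {a : ℕ} {n : ℕ → ℕ} {p c : ℕ} {ω : ℕ → ℕ → Finset Cell → k}
    (hω : ω ∈ blockCycles k a n p c) (i : ℕ) : contr (cell i (n i)) (ω i (n i)) = 0 := by
  have h := congrFun (hω.2.2 i i) (n i + n i)
  rwa [pairRel_self, blockOp_eq_lead (hω.1 i) cell_notMem_cellsBelow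
    (fun s hs => hω.2.1 i s (by omega))] at h

theorem contr_lead_add {a : ℕ} {n : ℕ → ℕ} {p c : ℕ} {ω : ℕ → ℕ → Finset Cell → k}
    (hω : ω ∈ blockCycles k a n p c) (i j : ℕ) :
    contr (cell i (n i)) (ω j (n j)) + contr (cell j (n j)) (ω i (n i)) = 0 := by
  rcases eq_or_ne i j with rfl | hij
  · rw [contr_lead_self hω, add_zero]
  have h := congrFun (hω.2.2 i j) (n i + n j)
  rwa [pairRel_of_ne ω hij, Pi.add_apply, blockOp_eq_lead (hω.1 j) cell_notMem_cellsBelow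
    (fun s hs => hω.2.1 j s (by omega)), add_comm (n i), blockOp_eq_lead (hω.1 i)
    cell_notMem_cellsBelow (fun s hs => hω.2.1 i s (by omega))] at h

end Cycles

section Count

variable {k : Type*} [Field k]

theorem cellsBelow_update {a i₀ N : ℕ} {n : ℕ → ℕ} (hN : n i₀ = N + 1) :
    cellsBelow a (Function.update n i₀ N) = (cellsBelow a n).erase (cell i₀ (N + 1)) := by
  ext v
  rw [← cell_ofLex v]
  generalize (ofLex v).1 = i
  generalize (ofLex v).2 = j
  rw [Finset.mem_erase, cell_mem_cellsBelow, cell_mem_cellsBelow, ne_eq, cell_inj]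
  rcases eq_or_ne i i₀ with rfl | hi
  · rw [Function.update_self, hN]
    omega
  · rw [Function.update_of_ne hi]
    omega

/-- The lead cells `(i, n i)`, `i ≤ a`. -/
def leadCells (a : ℕ) (n : ℕ → ℕ) : Finset Cell :=
  (Finset.range (a + 1)).image fun i => cell i (n i)

theorem mem_leadCells {a : ℕ} {n : ℕ → ℕ} {v : Cell} :
    v ∈ leadCells a n ↔ ∃ i ≤ a, cell i (n i) = v := by
  simp [leadCells]

theorem card_leadCells (a : ℕ) (n : ℕ → ℕ) : (leadCells a n).card = a + 1 := by
  rw [leadCells, Finset.card_image_of_injective _ fun i j h => (cell_inj.1 h).1,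
    Finset.card_range]

theorem card_cellsBelow_sdiff {a : ℕ} {m n : ℕ → ℕ} (hm : ∀ i, m i ≤ n i) :
    (cellsBelow a n \ leadCells a m).card = ∑ i ∈ Finset.range (a + 1), n i := by
  rw [Finset.card_sdiff_of_subset, card_cellsBelow, card_leadCells, Finset.sum_add_distrib]
  · simp
  · intro v hv
    obtain ⟨i, hi, rfl⟩ := mem_leadCells.1 hv
    exact cell_mem_cellsBelow.2 ⟨hi, hm i⟩

/-- The contraction with `v`, applied to each member of a family. -/
abbrev contrFamily (v : Cell) :
    (ℕ → ℕ → Finset Cell → k) →ₗ[k] (ℕ → ℕ → Finset Cell → k) :=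
  ((contr v).compLeft ℕ).compLeft ℕ

theorem contrFamily_apply (v : Cell) (ω : ℕ → ℕ → Finset Cell → k) (i j : ℕ) :
    contrFamily v ω i j = contr v (ω i j) := rfl

theorem pairRel_contrFamily (v : Cell) (ω : ℕ → ℕ → Finset Cell → k) (i j : ℕ) :
    pairRel (contrFamily v ω) i j = (-1 : k) • (contr v).compLeft ℕ (pairRel ω i j) :=
  pairRel_comp ((contr v).compLeft ℕ) (-1) (fun l e => by
    ext1 s
    rw [neg_smul, one_smul, Pi.neg_apply, LinearMap.compLeft_apply,
      Function.comp_apply, contr_blockOp, neg_neg]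
    rfl) ω i j

theorem map_contrFamily_blockCycles {a i₀ N P : ℕ} {n : ℕ → ℕ} (hi₀ : i₀ ≤ a)
    (hN : n i₀ = N + 1) :
    (blockCycles k a n (P + 1) 1).map (contrFamily (cell i₀ (N + 1))) =
      blockCycles k a (Function.update n i₀ N) P 1 := by
  have hT := cellsBelow_update (a := a) hN
  have hle : cellsBelow a (Function.update n i₀ N) ⊆ cellsBelow a n := by
    rw [hT]; exact Finset.erase_subset _ _
  apply le_antisymm
  · rintro _ ⟨ω, hω, rfl⟩
    refine ⟨fun i j => ?_, fun i j hij => ?_, fun i j => ?_⟩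
    · rw [hT]
      exact contr_mem_forms _ (hω.1 i j)
    · rw [contrFamily_apply]
      by_cases h : i = i₀ ∧ j = N + 1
      · obtain ⟨rfl, rfl⟩ := h
        have := contr_lead_self hω i
        rwa [hN] at this
      · rw [hω.2.1 i j, map_zero]
        rcases eq_or_ne i i₀ with rfl | hi
        · rw [Function.update_self] at hij
          omega
        · rwa [Function.update_of_ne hi] at hij
    · rw [pairRel_contrFamily, hω.2.2, map_zero, smul_zero]
  · intro α hα
    have hup : ∀ i, i ≠ i₀ → Function.update n i₀ N i = n i :=
      fun i hi => Function.update_of_ne hi _ _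
    have hyT : cell i₀ N ∈ cellsBelow a (Function.update n i₀ N) := by
      rw [cell_mem_cellsBelow, Function.update_self]
      exact ⟨hi₀, le_rfl⟩
    have htop : cell i₀ (N + 1) ∈ cellsBelow a n := by
      rw [cell_mem_cellsBelow, hN]
      exact ⟨hi₀, le_rfl⟩
    have htop' : cell i₀ (N + 1) ∉ cellsBelow a (Function.update n i₀ N) := by
      rw [hT]; exact Finset.notMem_erase _ _
    obtain ⟨c, hc, hcα⟩ := exists_contr_eq (T := cellsBelow a (Function.update n i₀ N)) (p := P)
      (fun i => cell i (Function.update n i₀ N i)) (fun i j h => (cell_inj.1 h).1)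
      ((Finset.range (a + 1)).erase i₀) (fun i => α i (Function.update n i₀ N i))
      (fun i hi => cell_mem_cellsBelow.2 ⟨by
        have := Finset.mem_range.1 (Finset.mem_of_mem_erase hi)
        omega, le_rfl⟩)
      (fun i _ => hα.1 i _) (fun i _ => contr_lead_self hα i)
      (fun i _ j _ => contr_lead_add hα i j)
    have hyc := lmulBasis_mem_forms hyT hc
    let ω : ℕ → ℕ → Finset Cell → k := (fun i => raiseSeq i₀ N (α i)) +
      fun i => shiftBy 1 (gradForm (lmulBasis (cell i₀ N) c) i)
    have hω : ∀ i j, ω i j = -lmulBasis (cell i₀ (N + 1)) (α i j) +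
        (if 1 ≤ j then lmulBasis (cell i₀ N) (α i (j - 1)) else 0) +
        (if 1 ≤ j then contr (cell i (j - 1)) (lmulBasis (cell i₀ N) c) else 0) :=
      fun i j => rfl
    refine ⟨-ω, neg_mem ⟨fun i j => ?_, fun i j hij => ?_, fun i j => ?_⟩, ?_⟩
    · rw [hω]
      refine add_mem (add_mem (neg_mem (lmulBasis_mem_forms htop (forms_mono hle _ (hα.1 i j))))
        ?_) ?_
      · split_ifs
        · exact forms_mono hle _ (lmulBasis_mem_forms hyT (hα.1 i _))
        · exact zero_mem _
      · split_ifs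
        · exact forms_mono hle _ (contr_mem_forms' _ hyc)
        · exact zero_mem _
    · rw [hω]
      have h0 : α i j = 0 := hα.2.1 i j fun h => hij ⟨h.1, h.2.1, by
        rcases eq_or_ne i i₀ with rfl | hi
        · rw [Function.update_self] at h; omega
        · rw [hup i hi] at h; omega⟩
      rw [h0, map_zero, neg_zero, zero_add]
      by_cases hj : 1 ≤ j
      · rw [if_pos hj, if_pos hj]
        by_cases hlead : i ≤ a ∧ i ≠ i₀ ∧ j - 1 = n i
        · obtain ⟨hia, hi, hjn⟩ := hlead
          have h1 := hcα i (Finset.mem_erase.2 ⟨hi, Finset.mem_range.2 (by omega)⟩)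
          rw [hup i hi] at h1
          rw [hjn, eq_neg_of_add_eq_zero_left (contr_lmulBasis_add
            (by rw [ne_eq, cell_inj]; tauto) c), h1, add_neg_cancel]
        · have h1 : ¬ (i ≤ a ∧ j - 1 ≤ Function.update n i₀ N i) := by
            rcases eq_or_ne i i₀ with rfl | hi
            · rw [Function.update_self]; omega
            · rw [hup i hi]; omega
          rw [hα.2.1 i (j - 1) (fun h => h1 ⟨h.1, h.2.2⟩), map_zero, zero_add]
          exact contr_eq_zero_of_notMem hyc fun h => h1 (cell_mem_cellsBelow.1 h)
      · rw [if_neg hj, if_neg hj, add_zero]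
    · rw [pairRel_add, pairRel_comp (raiseSeq i₀ N) (-1) (blockOp_raiseSeq i₀ N), hα.2.2,
        map_zero, smul_zero, zero_add, pairRel_comp (shiftBy 1) 1
        (fun l e => by rw [blockOp_shiftBy_one, one_smul]), pairRel_gradForm, map_zero, smul_zero]
    · rw [map_neg]
      ext1 i
      ext1 j
      have h1 : contr (cell i₀ (N + 1)) (α i j) = 0 := contr_eq_zero_of_notMem (hα.1 i j) htop'
      have h2 : contr (cell i₀ (N + 1)) (lmulBasis (cell i₀ (N + 1)) (α i j)) = α i j := by
        have := contr_lmulBasis_self_add (cell i₀ (N + 1)) (α i j)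
        rwa [h1, map_zero, add_zero] at this
      have h3 : contr (cell i₀ (N + 1)) (lmulBasis (cell i₀ N) (α i (j - 1))) = 0 :=
        contr_eq_zero_of_notMem (lmulBasis_mem_forms hyT (hα.1 i _)) htop'
      have h4 : contr (cell i₀ (N + 1)) (contr (cell i (j - 1)) (lmulBasis (cell i₀ N) c)) = 0 :=
        contr_eq_zero_of_notMem (contr_mem_forms' _ hyc) htop'
      rw [Pi.neg_apply, Pi.neg_apply, contrFamily_apply, hω, map_add, map_add, map_neg, h2]
      split_ifs
      · rw [h3, h4]; simp
      · simp

theorem mem_inf_ker_contrFamily {a i₀ N p : ℕ} {n : ℕ → ℕ} (hN : n i₀ = N + 1)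
    {ω : ℕ → ℕ → Finset Cell → k} :
    ω ∈ blockCycles k a n p 1 ⊓ LinearMap.ker (contrFamily (cell i₀ (N + 1))) ↔
      ω ∈ blockCycles k a n p 1 ∧
        ∀ i j, ω i j ∈ forms k (cellsBelow a (Function.update n i₀ N)) p := by
  rw [Submodule.mem_inf, LinearMap.mem_ker]
  refine and_congr_right fun hω => ⟨fun h i j => ?_, fun h => ?_⟩
  · rw [cellsBelow_update hN]
    exact mem_forms_erase (hω.1 i j) (congrFun (congrFun h i) j)
  · ext1 i
    ext1 j
    refine contr_eq_zero_of_notMem (h i j) ?_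
    rw [cellsBelow_update hN]
    exact Finset.notMem_erase _ _

theorem map_proj_inf_ker {a i₀ N p : ℕ} {n : ℕ → ℕ} (hi₀ : i₀ ≤ a) (hN : n i₀ = N + 1) :
    (blockCycles k a n p 1 ⊓ LinearMap.ker (contrFamily (cell i₀ (N + 1)))).map
        (LinearMap.proj (N + 1) ∘ₗ LinearMap.proj i₀) =
      forms k (cellsBelow a (Function.update n i₀ N) \ leadCells a (Function.update n i₀ N)) p := by
  have hup : ∀ i, i ≠ i₀ → Function.update n i₀ N i = n i :=
    fun i hi => Function.update_of_ne hi _ _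
  apply le_antisymm
  · rintro _ ⟨ω, hω, rfl⟩
    rw [SetLike.mem_coe, mem_inf_ker_contrFamily hN] at hω
    obtain ⟨hω, hωT⟩ := hω
    refine mem_forms_sdiff (hωT i₀ (N + 1)) fun v hv => ?_
    obtain ⟨i, hi, rfl⟩ := mem_leadCells.1 hv
    have hsupp : ∀ i s, n i < s → ω i s = 0 := fun i s hs => hω.2.1 i s (by omega)
    have h1 := blockOp_eq_lead (l := i) (hωT i₀) cell_notMem_cellsBelow
      (t := N + 1) (fun s hs => hsupp i₀ s (by omega))
    have h2 := congrFun (hω.2.2 i i₀) (Function.update n i₀ N i + (N + 1))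
    change contr _ (ω i₀ (N + 1)) = 0
    rw [← h1]
    rcases eq_or_ne i i₀ with rfl | hii
    · rwa [pairRel_self] at h2
    · rw [pairRel_of_ne _ hii, Pi.add_apply, blockOp_eq_zero_of_lead_lt (l := i₀) (hωT i)
        cell_notMem_cellsBelow (t := n i) (hsupp i), add_zero] at h2
      · exact h2
      · rw [Function.update_self, hup i hii]
        omega
  · intro τ hτ
    have hτ' := forms_mono Finset.sdiff_subset _ hτ
    have hlead : ∀ i ≤ a, contr (cell i (Function.update n i₀ N i)) τ = 0 := fun i hi =>
      contr_eq_zero_of_notMem hτ fun h => (Finset.mem_sdiff.1 h).2 (mem_leadCells.2 ⟨i, hi, rfl⟩)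
    have hyT : cell i₀ N ∈ cellsBelow a (Function.update n i₀ N) := by
      rw [cell_mem_cellsBelow, Function.update_self]
      exact ⟨hi₀, le_rfl⟩
    have hyτ := lmulBasis_mem_forms hyT hτ'
    have hle : cellsBelow a (Function.update n i₀ N) ⊆ cellsBelow a n := by
      rw [cellsBelow_update hN]; exact Finset.erase_subset _ _
    let ω : ℕ → ℕ → Finset Cell → k :=
      fun i => shiftBy 1 (gradForm (lmulBasis (cell i₀ N) τ) i)
    have hω : ∀ i j, ω i j =
        if 1 ≤ j then contr (cell i (j - 1)) (lmulBasis (cell i₀ N) τ) else 0 := fun i j => rfl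
    have hωT : ∀ i j, ω i j ∈ forms k (cellsBelow a (Function.update n i₀ N)) p := by
      intro i j
      rw [hω]
      split_ifs
      · exact contr_mem_forms' _ hyτ
      · exact zero_mem _
    refine ⟨ω, (mem_inf_ker_contrFamily hN).2 ⟨⟨fun i j => forms_mono hle _ (hωT i j),
      fun i j hij => ?_, fun i j => ?_⟩, hωT⟩, ?_⟩
    · rw [hω]
      split_ifs with hj
      · by_cases hl : i ≤ a ∧ i ≠ i₀ ∧ j - 1 = n i
        · obtain ⟨hia, hi, hjn⟩ := hl
          have h1 := hlead i hia
          rw [hup i hi] at h1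
          rw [hjn, eq_neg_of_add_eq_zero_left (contr_lmulBasis_add
            (by rw [ne_eq, cell_inj]; tauto) τ), h1, map_zero, neg_zero]
        · refine contr_eq_zero_of_notMem hyτ fun h => ?_
          have h1 := cell_mem_cellsBelow.1 h
          rcases eq_or_ne i i₀ with rfl | hi
          · rw [Function.update_self] at h1; omega
          · rw [hup i hi] at h1; omega
      · rfl
    · rw [pairRel_comp (shiftBy 1) 1 (fun l e => by rw [blockOp_shiftBy_one, one_smul]),
        pairRel_gradForm, map_zero, smul_zero]
    · change ω i₀ (N + 1) = τ
      have h1 := contr_lmulBasis_self_add (cell i₀ N) τ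
      have h2 := hlead i₀ hi₀
      rw [Function.update_self] at h2
      rw [h2, map_zero, add_zero] at h1
      rw [hω, if_pos (by omega), Nat.add_sub_cancel, h1]

theorem inf_ker_inf_ker_proj {a i₀ N p : ℕ} {n : ℕ → ℕ} (hN : n i₀ = N + 1) :
    (blockCycles k a n p 1 ⊓ LinearMap.ker (contrFamily (cell i₀ (N + 1)))) ⊓
        LinearMap.ker (LinearMap.proj (N + 1) ∘ₗ LinearMap.proj i₀ :
          (ℕ → ℕ → Finset Cell → k) →ₗ[k] (Finset Cell → k)) =
      blockCycles k a (Function.update n i₀ N) p 1 := by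
  have hup : ∀ i, i ≠ i₀ → Function.update n i₀ N i = n i :=
    fun i hi => Function.update_of_ne hi _ _
  have hle : cellsBelow a (Function.update n i₀ N) ⊆ cellsBelow a n := by
    rw [cellsBelow_update hN]; exact Finset.erase_subset _ _
  ext ω
  rw [Submodule.mem_inf, mem_inf_ker_contrFamily hN, LinearMap.mem_ker]
  change _ ∧ ω i₀ (N + 1) = 0 ↔ _
  constructor
  · rintro ⟨⟨hω, hωT⟩, h0⟩
    refine ⟨hωT, fun i j hij => ?_, hω.2.2⟩
    by_cases h : i = i₀ ∧ j = N + 1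
    · rw [h.1, h.2, h0]
    · refine hω.2.1 i j ?_
      rcases eq_or_ne i i₀ with rfl | hi
      · rw [Function.update_self] at hij; omega
      · rwa [hup i hi] at hij
  · rintro ⟨h1, h2, h3⟩
    refine ⟨⟨⟨fun i j => forms_mono hle _ (h1 i j), fun i j hij => h2 i j ?_, h3⟩, h1⟩,
      h2 _ _ ?_⟩
    · rcases eq_or_ne i i₀ with rfl | hi
      · rw [Function.update_self]; omega
      · rwa [hup i hi]
    · rw [Function.update_self]; omega

theorem finrank_blockCycles_one (a : ℕ) (n : ℕ → ℕ) (p : ℕ) :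
    Module.finrank k (blockCycles k a n p 1) =
      (p + 1) * (∑ i ∈ Finset.range (a + 1), n i).choose (p + 1) := by
  induction hs : ∑ i ∈ Finset.range (a + 1), n i generalizing n p with
  | zero =>
    have h0 : blockCycles k a n p 1 = ⊥ := by
      rw [eq_bot_iff]
      intro ω hω
      rw [Submodule.mem_bot]
      ext1 i
      ext1 j
      refine hω.2.1 i j fun h => ?_
      have := Finset.sum_eq_zero_iff.1 hs i (Finset.mem_range.2 (by omega))
      omega
    rw [h0, finrank_bot, Nat.choose_zero_succ, mul_zero]
  | succ s ih =>
    obtain ⟨i₀, hi₀, hne⟩ : ∃ i ∈ Finset.range (a + 1), n i ≠ 0 :=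
      Finset.exists_ne_zero_of_sum_ne_zero (by omega)
    have hi₀' : i₀ ≤ a := by have := Finset.mem_range.1 hi₀; omega
    obtain ⟨N, hN⟩ : ∃ N, n i₀ = N + 1 := ⟨n i₀ - 1, by omega⟩
    have hsum : ∑ i ∈ Finset.range (a + 1), Function.update n i₀ N i = s := by
      have h1 := Finset.add_sum_erase _ n hi₀
      rw [← Finset.add_sum_erase _ _ hi₀, Function.update_self,
        Finset.sum_congr rfl fun i hi => Function.update_of_ne (Finset.ne_of_mem_erase hi) _ _]
      omega
    have : Module.Finite k (blockCycles k a n p 1 ⊓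
        LinearMap.ker (contrFamily (cell i₀ (N + 1))) : Submodule k _) :=
      Submodule.finiteDimensional_of_le inf_le_left
    have hK := Submodule.finrank_map_add_finrank_inf_ker (k := k)
      (LinearMap.proj (N + 1) ∘ₗ LinearMap.proj i₀)
      (blockCycles k a n p 1 ⊓ LinearMap.ker (contrFamily (cell i₀ (N + 1))))
    rw [map_proj_inf_ker hi₀' hN, inf_ker_inf_ker_proj hN, finrank_forms,
      card_cellsBelow_sdiff (fun _ => le_rfl), hsum, ih _ p hsum] at hK
    have hZ := Submodule.finrank_map_add_finrank_inf_ker (contrFamily (cell i₀ (N + 1)))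
      (blockCycles k a n p 1)
    rw [← hK] at hZ
    rw [← hZ]
    rcases p with _ | P
    · have h0 : (blockCycles k a n 0 1).map (contrFamily (cell i₀ (N + 1))) = ⊥ := by
        rw [eq_bot_iff]
        rintro _ ⟨ω, hω, rfl⟩
        rw [Submodule.mem_bot]
        ext1 i
        ext1 j
        exact contr_forms_zero _ (hω.1 i j)
      rw [h0, finrank_bot]
      simp
      omega
    · rw [map_contrFamily_blockCycles hi₀' hN, ih _ P hsum, Nat.choose_succ_succ s (P + 1)]
      ring

/-- The Koszul boundaries: families of contractions of a single form. -/
def blockBoundaries (k : Type*) [Field k] (a b p : ℕ) : Submodule k (ℕ → ℕ → Finset Cell → k) :=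
  (forms k (cellsBelow a fun _ => b) (p + 1)).map gradForm

theorem blockBoundaries_le {a b p : ℕ} :
    blockBoundaries k a b p ≤ blockCycles k a (fun _ => b) p 0 := by
  rintro _ ⟨η, hη, rfl⟩
  refine ⟨fun i j => contr_mem_forms' _ hη, fun i j hij => ?_, pairRel_gradForm η⟩
  refine contr_eq_zero_of_notMem hη fun h => hij ?_
  obtain ⟨h1, h2⟩ := cell_mem_cellsBelow.1 h
  exact ⟨h1, Nat.zero_le j, h2⟩

theorem finrank_blockCycles_zero (a b p : ℕ) :
    Module.finrank k (blockCycles k a (fun _ => b) p 0) =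
      Module.finrank k (blockBoundaries k a b p) + p * ((a + 1) * b).choose (p + 1) := by
  let φ : (ℕ → ℕ → Finset Cell → k) →ₗ[k] (ℕ → Finset Cell → k) :=
    (LinearMap.proj 0).compLeft ℕ
  have hφ : ∀ ω i, φ ω i = ω i 0 := fun ω i => rfl
  have hle := blockBoundaries_le (k := k) (a := a) (b := b) (p := p)
  have hfin : Module.Finite k (blockBoundaries k a b p) :=
    Submodule.finiteDimensional_of_le hle
  have hZ := Submodule.finrank_map_add_finrank_inf_ker φ (blockCycles k a (fun _ => b) p 0)
  have hB := Submodule.finrank_map_add_finrank_inf_ker φ (blockBoundaries k a b p)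
  have hmap : (blockCycles k a (fun _ => b) p 0).map φ = (blockBoundaries k a b p).map φ := by
    refine le_antisymm ?_ (Submodule.map_mono hle)
    rintro _ ⟨ω, hω, rfl⟩
    have hr := fun i j => congrFun (hω.2.2 i j) 0
    obtain ⟨η, hη, hηω⟩ := exists_contr_eq (T := cellsBelow a fun _ => b) (p := p)
      (fun i => cell i 0) (fun i j h => (cell_inj.1 h).1) (Finset.range (a + 1))
      (fun i => ω i 0)
      (fun i hi => cell_mem_cellsBelow.2 ⟨by
        have := Finset.mem_range.1 hi
        omega, Nat.zero_le _⟩)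
      (fun i _ => hω.1 i 0) (fun i _ => by
        have h := hr i i
        rw [pairRel_self, blockOp_apply] at h
        simpa using h)
      (fun i _ j _ => by
        rcases eq_or_ne i j with rfl | hij
        · have h := hr i i
          rw [pairRel_self, blockOp_apply] at h
          have h' : contr (cell i 0) (ω i 0) = 0 := by simpa using h
          rw [h', add_zero]
        · have h := hr i j
          rw [pairRel_of_ne _ hij, Pi.add_apply, blockOp_apply, blockOp_apply] at h
          simpa using h)
    refine ⟨gradForm η, ⟨η, hη, rfl⟩, ?_⟩
    ext1 i
    rw [hφ, hφ, gradForm_apply]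
    by_cases hi : i ≤ a
    · exact hηω i (Finset.mem_range.2 (by omega))
    · rw [hω.2.1 i 0 (by omega)]
      exact contr_eq_zero_of_notMem hη fun h => hi (cell_mem_cellsBelow.1 h).1
  have hker : blockCycles k a (fun _ => b) p 0 ⊓ LinearMap.ker φ =
      blockCycles k a (fun _ => b) p 1 := by
    ext ω
    rw [Submodule.mem_inf, LinearMap.mem_ker]
    constructor
    · rintro ⟨hω, h0⟩
      refine ⟨hω.1, fun i j hij => ?_, hω.2.2⟩
      rcases j with _ | j
      · exact congrFun h0 i
      · exact hω.2.1 i (j + 1) (by omega)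
    · intro hω
      exact ⟨⟨hω.1, fun i j hij => hω.2.1 i j (by omega), hω.2.2⟩,
        funext fun i => hω.2.1 i 0 (by omega)⟩
  have hkerB : blockBoundaries k a b p ⊓ LinearMap.ker φ =
      (forms k (cellsBelow a (fun _ => b) \ leadCells a fun _ => 0) (p + 1)).map gradForm := by
    apply le_antisymm
    · rintro _ ⟨⟨η, hη, rfl⟩, h0⟩
      refine ⟨η, mem_forms_sdiff hη fun v hv => ?_, rfl⟩
      obtain ⟨i, hi, rfl⟩ := mem_leadCells.1 hv
      exact congrFun h0 i
    · rintro _ ⟨η, hη, rfl⟩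
      refine ⟨⟨η, forms_mono Finset.sdiff_subset _ hη, rfl⟩, ?_⟩
      rw [SetLike.mem_coe, LinearMap.mem_ker]
      ext1 i
      refine contr_eq_zero_of_notMem hη fun h => ?_
      obtain ⟨h1, h2⟩ := Finset.mem_sdiff.1 h
      exact h2 (mem_leadCells.2 ⟨i, (cell_mem_cellsBelow.1 h1).1, rfl⟩)
  have hinj : Module.finrank k ((forms k (cellsBelow a (fun _ => b) \ leadCells a fun _ => 0)
      (p + 1)).map gradForm) = ((a + 1) * b).choose (p + 1) := by
    have h := Submodule.finrank_map_add_finrank_inf_ker (gradForm (k := k))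
      (forms k (cellsBelow a (fun _ => b) \ leadCells a fun _ => 0) (p + 1))
    have h0 : forms k (cellsBelow a (fun _ => b) \ leadCells a fun _ => 0) (p + 1) ⊓
        LinearMap.ker gradForm = ⊥ := by
      rw [eq_bot_iff]
      rintro η ⟨hη, hη0⟩
      rw [SetLike.mem_coe, LinearMap.mem_ker] at hη0
      exact eq_zero_of_contr_eq_zero hη fun v _ =>
        congrFun (congrFun hη0 (ofLex v).1) (ofLex v).2
    rw [h0, finrank_bot, add_zero, finrank_forms, card_cellsBelow_sdiff (fun _ => Nat.zero_le _)]
      at h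
    rw [h]
    simp
  rw [hker, hmap, finrank_blockCycles_one] at hZ
  rw [hkerB, hinj] at hB
  simp only [Finset.sum_const, Finset.card_range, smul_eq_mul] at hZ
  rw [← hZ, ← hB]
  ring

end Count

section Bridge

/-- The exponent of the monomial of bidegree `(d, e)` indexed by the cell `(i, j)`. -/
def cellExponent (d e : ℕ) (c : Cell) : Fin 4 →₀ ℕ :=
  Finsupp.equivFunOnFinite.symm
    ![(ofLex c).1, d - (ofLex c).1, (ofLex c).2, e - (ofLex c).2]

theorem cellExponent_add {d e d' e' : ℕ} {c c' : Cell}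
    (hc : c ∈ cellsBelow d fun _ => e) (hc' : c' ∈ cellsBelow d' fun _ => e') :
    cellExponent d e c + cellExponent d' e' c' = cellExponent (d + d') (e + e') (c + c') := by
  rw [← cell_ofLex c, cell_mem_cellsBelow] at hc
  rw [← cell_ofLex c', cell_mem_cellsBelow] at hc'
  ext t
  fin_cases t <;> simp [cellExponent] <;> omega

/-- The exponents of the monomials of bidegree `(d, e)`. -/
def bidegreeExponents (d e : ℕ) : Set (Fin 4 →₀ ℕ) := {m | m 0 + m 1 = d ∧ m 2 + m 3 = e}

/-- The exponents of the monomials of bidegree `(d, e)` correspond to the cells `(i, j)` with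
`i ≤ d` and `j ≤ e`. -/
def cellEquivExponents (d e : ℕ) : ↥(cellsBelow d fun _ => e) ≃ bidegreeExponents d e where
  toFun c := ⟨cellExponent d e c, by
    have hc := c.2
    rw [← cell_ofLex c.1, cell_mem_cellsBelow] at hc
    simp [bidegreeExponents, cellExponent]
    omega⟩
  invFun m := ⟨cell (m.1 0) (m.1 2), by
    obtain ⟨m, h0, h2⟩ := m
    rw [cell_mem_cellsBelow]
    dsimp
    omega⟩
  left_inv c := by
    apply Subtype.ext
    simp [cellExponent, cell]
  right_inv m := by
    obtain ⟨m, h0, h2⟩ := m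
    apply Subtype.ext
    ext t
    fin_cases t <;> simp [cellExponent, cell] <;> omega

variable (k : Type*) [Field k]

theorem bihom_eq_restrictSupport (d e : ℕ) :
    restrictSupport k (bidegreeExponents d e) = Bihom k d e := by
  ext f
  exact mem_restrictSupport_iff k

/-- The monomial basis of the bihomogeneous polynomials of bidegree `(d, e)`. -/
def bihomBasis (d e : ℕ) : Module.Basis ↥(cellsBelow d fun _ => e) k (Bihom k d e) :=
  ((basisRestrictSupport k (bidegreeExponents d e)).reindex (cellEquivExponents d e).symm).map
    (LinearEquiv.ofEq _ _ (bihom_eq_restrictSupport k d e))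

theorem coe_bihomBasis (d e : ℕ) (c : ↥(cellsBelow d fun _ => e)) :
    (bihomBasis k d e c : MvPolynomial (Fin 4) k) = monomial (cellExponent d e c) 1 := by
  simp only [bihomBasis, Module.Basis.map_apply, Module.Basis.reindex_apply, Equiv.symm_symm,
    LinearEquiv.coe_ofEq_apply]
  generalize hm : cellEquivExponents d e c = m
  rw [show cellExponent d e c = m by rw [← hm]; rfl]
  have h : basisRestrictSupport k (bidegreeExponents d e) m =
      ⟨monomial m.1 1, (monomial_mem_restrictSupport k).2 (Or.inl m.2)⟩ := by
    rw [Module.Basis.apply_eq_iff]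
    ext m'
    change coeff m'.1 (monomial m.1 (1 : k)) = _
    rw [coeff_monomial, Finsupp.single_apply]
    simp [Subtype.ext_iff]
  rw [h]

theorem add_mem_cellsBelow {d e d' e' : ℕ} {c c' : Cell}
    (hc : c ∈ cellsBelow d fun _ => e) (hc' : c' ∈ cellsBelow d' fun _ => e') :
    c + c' ∈ cellsBelow (d + d') fun _ => e + e' := by
  rw [← cell_ofLex c, cell_mem_cellsBelow] at hc
  rw [← cell_ofLex c', cell_mem_cellsBelow] at hc'
  rw [← cell_ofLex (c + c'), cell_mem_cellsBelow, ofLex_add, Prod.fst_add, Prod.snd_add]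
  omega

end Bridge

section Families

open Finset.HasAntidiagonal (antidiagonal mem_antidiagonal)

variable (k : Type*) [Field k]

/-- The family of forms with a single coefficient `1`, at the cell `c` and the set `S`. -/
def unitFamily (c : Cell) (S : Finset Cell) : ℕ → ℕ → Finset Cell → k :=
  fun i j U => if cell i j = c ∧ U = S then 1 else 0

variable {k} in
/-- The Koszul differential on families of forms. -/
def totalOp : (ℕ → ℕ → Finset Cell → k) →ₗ[k] (ℕ → ℕ → Finset Cell → k) where
  toFun ω r := ∑ q ∈ antidiagonal r, blockOp q.1 (ω q.2)
  map_add' ω ω' := by ext1 r; simp [Finset.sum_add_distrib]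
  map_smul' c ω := by ext1 r; simp [Finset.smul_sum]

variable {k} in
theorem totalOp_apply (ω : ℕ → ℕ → Finset Cell → k) (r : ℕ) :
    totalOp ω r = ∑ q ∈ antidiagonal r, blockOp q.1 (ω q.2) := rfl

theorem contr_unitFamily (v c : Cell) (S : Finset Cell) (i j : ℕ) (U : Finset Cell) :
    contr v (unitFamily k c S i j) U = ∑ s ∈ S, if v = s ∧ cell i j = c then
      (if U = S.erase s then koszulSign k s (S.erase s) else 0) else 0 := by
  rw [contr_apply]
  unfold unitFamily
  by_cases hc : cell i j = c
  · simp only [hc, true_and, and_true, Finset.sum_ite_eq]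
    by_cases hvU : v ∈ U
    · rw [if_pos hvU]
      split_ifs with h1 h2
      · rw [h2] at hvU
        exact absurd hvU (Finset.notMem_erase v S)
      · rfl
      · rfl
    · rw [if_neg hvU]
      by_cases h : insert v U = S
      · rw [if_pos h, if_pos (h ▸ Finset.mem_insert_self v U), ← h, Finset.erase_insert hvU]
        simp
      · rw [if_neg h, mul_zero]
        split_ifs with h1 h2
        · exact absurd (by rw [h2, Finset.insert_erase h1]) h
        · rfl
        · rfl
  · simp [hc]

theorem totalOp_unitFamily (c : Cell) (S : Finset Cell) :
    totalOp (unitFamily k c S) =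
      ∑ s ∈ S, koszulSign k s (S.erase s) • unitFamily k (s + c) (S.erase s) := by
  ext r t U
  simp only [totalOp_apply, blockOp_apply, Finset.sum_apply, contr_unitFamily, Pi.smul_apply,
    smul_eq_mul]
  have h : ∀ x ∈ antidiagonal r, ∑ y ∈ antidiagonal t, ∑ s ∈ S,
      (if cell x.1 y.1 = s ∧ cell x.2 y.2 = c then
        (if U = S.erase s then koszulSign k s (S.erase s) else 0) else 0) =
      ∑ s ∈ S, ∑ y ∈ antidiagonal t, (if cell x.1 y.1 = s ∧ cell x.2 y.2 = c then
        (if U = S.erase s then koszulSign k s (S.erase s) else 0) else 0) :=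
    fun x _ => Finset.sum_comm
  rw [Finset.sum_congr rfl h, Finset.sum_comm]
  refine Finset.sum_congr rfl fun s _ => ?_
  obtain ⟨s₁, s₂, rfl⟩ : ∃ s₁ s₂, s = cell s₁ s₂ := ⟨_, _, (cell_ofLex s).symm⟩
  obtain ⟨c₁, c₂, rfl⟩ : ∃ c₁ c₂, c = cell c₁ c₂ := ⟨_, _, (cell_ofLex c).symm⟩
  have h' : ∀ x y : ℕ × ℕ, (cell x.1 y.1 = cell s₁ s₂ ∧ cell x.2 y.2 = cell c₁ c₂) ↔
      (x = (s₁, c₁) ∧ y = (s₂, c₂)) := by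
    rintro ⟨x1, x2⟩ ⟨y1, y2⟩
    simp only [cell_inj, Prod.mk.injEq]
    tauto
  simp only [h', ite_and, Finset.sum_ite_irrel, Finset.sum_ite_eq', Finset.sum_const_zero,
    mem_antidiagonal]
  have h2 : cell r t = cell s₁ s₂ + cell c₁ c₂ ↔ s₁ + c₁ = r ∧ s₂ + c₂ = t := by
    rw [show cell s₁ s₂ + cell c₁ c₂ = cell (s₁ + c₁) (s₂ + c₂) from rfl, cell_inj]
    tauto
  unfold unitFamily
  simp only [h2, ite_and, mul_ite, mul_one, mul_zero]

/-- The monomial basis of `Λ^p V ⊗ R_q`. -/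
def koszulBasis (a b p q : ℕ) : Module.Basis
    (Set.powersetCard ↥(cellsBelow (1 * a) fun _ => 1 * b) p × ↥(cellsBelow (q * a) fun _ => q * b))
    k ((⋀[k]^p (RS k a b 1)) ⊗[k] (RS k a b q)) :=
  ((bihomBasis k (1 * a) (1 * b)).exteriorPower p).tensorProduct (bihomBasis k (q * a) (q * b))

theorem koszulBasis_apply (a b p q : ℕ)
    (S : Set.powersetCard ↥(cellsBelow (1 * a) fun _ => 1 * b) p)
    (c : ↥(cellsBelow (q * a) fun _ => q * b)) :
    koszulBasis k a b p q (S, c) =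
      wedge k p (fun i => bihomBasis k (1 * a) (1 * b) (S.1.orderEmbOfFin S.2 i)) ⊗ₜ[k]
        bihomBasis k (q * a) (q * b) c := by
  rw [koszulBasis, Module.Basis.tensorProduct_apply, exteriorPower.basis_apply]
  rfl

/-- The set of cells underlying a set of basis vectors of `V`. -/
def cellSet {T : Finset Cell} (S : Finset ↥T) : Finset Cell := S.map (Function.Embedding.subtype _)

/-- An element of `Λ^p V ⊗ R_q`, as a family of forms. -/
def toFamily (a b p q : ℕ) :
    ((⋀[k]^p (RS k a b 1)) ⊗[k] (RS k a b q)) →ₗ[k] (ℕ → ℕ → Finset Cell → k) :=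
  (koszulBasis k a b p q).constr k fun x => unitFamily k x.2 (cellSet x.1.1)

theorem toFamily_basis (a b p q : ℕ) (x) :
    toFamily k a b p q (koszulBasis k a b p q x) = unitFamily k x.2 (cellSet x.1.1) :=
  Module.Basis.constr_basis _ _ _ _

theorem cellSet_injective {T : Finset Cell} : Function.Injective (cellSet (T := T)) :=
  Finset.map_injective _

theorem toFamily_apply_cellSet (a b p q : ℕ) (z : (⋀[k]^p (RS k a b 1)) ⊗[k] (RS k a b q)) (x) :
    toFamily k a b p q z (ofLex x.2.1).1 (ofLex x.2.1).2 (cellSet x.1.1) =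
      (koszulBasis k a b p q).repr z x := by
  let ev : (ℕ → ℕ → Finset Cell → k) →ₗ[k] k :=
    { toFun := fun ω => ω (ofLex x.2.1).1 (ofLex x.2.1).2 (cellSet x.1.1)
      map_add' := fun _ _ => rfl
      map_smul' := fun _ _ => rfl }
  suffices h : ev.comp (toFamily k a b p q) = (koszulBasis k a b p q).coord x from
    LinearMap.congr_fun h z
  refine (koszulBasis k a b p q).ext fun y => ?_
  rw [LinearMap.comp_apply, toFamily_basis, Module.Basis.coord_apply, Module.Basis.repr_self,
    Finsupp.single_apply]
  change (if cell _ _ = _ ∧ _ then (1 : k) else 0) = _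
  rw [cell_ofLex]
  refine if_congr ?_ rfl rfl
  rw [cellSet_injective.eq_iff, Prod.ext_iff, Subtype.ext_iff, Subtype.ext_iff]
  tauto

theorem toFamily_injective (a b p q : ℕ) : Function.Injective (toFamily k a b p q) := by
  intro z z' h
  refine (koszulBasis k a b p q).ext_elem fun x => ?_
  rw [← toFamily_apply_cellSet, ← toFamily_apply_cellSet, h]

/-- The families of `p`-forms corresponding to the elements of `Λ^p V ⊗ R_q`. -/
def families (a b p q : ℕ) : Submodule k (ℕ → ℕ → Finset Cell → k) where
  carrier := {ω | (∀ i j, ω i j ∈ forms k (cellsBelow a fun _ => b) p) ∧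
    ∀ i j, ¬ (i ≤ q * a ∧ j ≤ q * b) → ω i j = 0}
  add_mem' h h' := ⟨fun i j => add_mem (h.1 i j) (h'.1 i j), fun i j hij => by
    rw [Pi.add_apply, Pi.add_apply, h.2 i j hij, h'.2 i j hij, add_zero]⟩
  zero_mem' := ⟨fun _ _ => zero_mem _, fun _ _ _ => rfl⟩
  smul_mem' c _ h := ⟨fun i j => Submodule.smul_mem _ c (h.1 i j), fun i j hij => by
    rw [Pi.smul_apply, Pi.smul_apply, h.2 i j hij, smul_zero]⟩

theorem unitFamily_mem_families {a b p q : ℕ} {c : Cell} {S : Finset Cell}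
    (hc : c ∈ cellsBelow (q * a) fun _ => q * b) (hS : S ⊆ cellsBelow a fun _ => b)
    (hp : S.card = p) : unitFamily k c S ∈ families k a b p q := by
  refine ⟨fun i j U hU => ?_, fun i j hij => ?_⟩
  · have h : cell i j = c ∧ U = S := by
      by_contra h
      exact hU (if_neg h)
    exact h.2 ▸ ⟨hS, hp⟩
  · ext U
    refine if_neg fun h => hij ?_
    rwa [← cell_mem_cellsBelow (n := fun _ => q * b), h.1]

theorem range_toFamily_le (a b p q : ℕ) :
    LinearMap.range (toFamily k a b p q) ≤ families k a b p q := by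
  rw [toFamily, Module.Basis.constr_range, Submodule.span_le]
  rintro _ ⟨⟨S, c⟩, rfl⟩
  refine unitFamily_mem_families k c.2 (fun v hv => ?_) ((Finset.card_map _).trans S.2)
  obtain ⟨u, -, rfl⟩ := Finset.mem_map.1 hv
  have hu := u.2
  simp only [one_mul] at hu
  exact hu

theorem range_toFamily (a b p q : ℕ) :
    LinearMap.range (toFamily k a b p q) = families k a b p q := by
  refine le_antisymm (range_toFamily_le k a b p q) fun ω hω => ?_
  let z := ∑ x, ω (ofLex x.2.1).1 (ofLex x.2.1).2 (cellSet x.1.1) • koszulBasis k a b p q x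
  have hz : toFamily k a b p q z ∈ families k a b p q :=
    range_toFamily_le k a b p q (LinearMap.mem_range_self _ z)
  refine ⟨z, ?_⟩
  ext i j U
  by_cases hij : i ≤ q * a ∧ j ≤ q * b
  · by_cases hU : U ⊆ (cellsBelow a fun _ => b) ∧ U.card = p
    · obtain ⟨hUT, hUp⟩ := hU
      have hUT' : U ⊆ cellsBelow (1 * a) fun _ => 1 * b := by simpa only [one_mul] using hUT
      have hS : cellSet (U.subtype (· ∈ cellsBelow (1 * a) fun _ => 1 * b)) = U :=
        Finset.subtype_map_of_mem fun v hv => hUT' hv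
      have hcard : (U.subtype (· ∈ cellsBelow (1 * a) fun _ => 1 * b)).card = p := by
        rw [← hUp]
        conv_rhs => rw [← hS]
        exact (Finset.card_map _).symm
      have h := toFamily_apply_cellSet k a b p q z
        (⟨_, hcard⟩, ⟨cell i j, cell_mem_cellsBelow.2 hij⟩)
      rw [Module.Basis.repr_sum_self] at h
      simpa only [hS, cell, ofLex_toLex] using h
    · have h0 : ∀ ω' ∈ families k a b p q, ω' i j U = 0 := fun ω' h' =>
        by_contra fun h => hU (h'.1 i j U h)
      rw [h0 _ hz, h0 _ hω]
  · rw [hz.2 i j hij, hω.2 i j hij]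

end Families

section Intertwine

variable (k : Type*) [Field k]

theorem add_mem_cellsBelow_succ_mul {a b q : ℕ} {s c : Cell}
    (hs : s ∈ cellsBelow (1 * a) fun _ => 1 * b) (hc : c ∈ cellsBelow (q * a) fun _ => q * b) :
    s + c ∈ cellsBelow ((q + 1) * a) fun _ => (q + 1) * b := by
  have h := add_mem_cellsBelow hs hc
  rwa [← add_mul, ← add_mul, add_comm 1 q] at h

theorem segMul_bihomBasis (a b q : ℕ) (s : ↥(cellsBelow (1 * a) fun _ => 1 * b))
    (c : ↥(cellsBelow (q * a) fun _ => q * b)) :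
    segMul k a b q (bihomBasis k (1 * a) (1 * b) s) (bihomBasis k (q * a) (q * b) c) =
      bihomBasis k ((q + 1) * a) ((q + 1) * b) ⟨s + c, add_mem_cellsBelow_succ_mul s.2 c.2⟩ := by
  apply Subtype.ext
  rw [coe_bihomBasis]
  change (bihomBasis k (1 * a) (1 * b) s : MvPolynomial (Fin 4) k) *
    (bihomBasis k (q * a) (q * b) c : MvPolynomial (Fin 4) k) = _
  rw [coe_bihomBasis, coe_bihomBasis, monomial_mul, mul_one, cellExponent_add s.2 c.2, ← add_mul,
    ← add_mul, add_comm 1 q]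

theorem Finset.orderEmbOfFin_succAbove {I : Type*} [LinearOrder I] {n : ℕ} {S : Finset I}
    (hS : S.card = n + 1) (i : Fin (n + 1)) (hS' : (S.erase (S.orderEmbOfFin hS i)).card = n)
    (j : Fin n) :
    S.orderEmbOfFin hS (i.succAbove j) = (S.erase (S.orderEmbOfFin hS i)).orderEmbOfFin hS' j := by
  refine congrFun (Finset.orderEmbOfFin_unique hS' (f := fun j => S.orderEmbOfFin hS (i.succAbove j))
    (fun j => ?_) fun j j' h => ?_) j
  · rw [Finset.mem_erase]
    exact ⟨fun h => i.succAbove_ne j ((S.orderEmbOfFin hS).injective h),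
      S.orderEmbOfFin_mem hS _⟩
  · exact (S.orderEmbOfFin hS).strictMono ((Fin.strictMono_succAbove i) h)

theorem koszulSign_cellSet {T : Finset Cell} {n : ℕ} {S : Finset ↥T}
    (hS : S.card = n + 1) (i : Fin (n + 1)) :
    koszulSign k (S.orderEmbOfFin hS i : Cell) ((cellSet S).erase (S.orderEmbOfFin hS i)) =
      (-1) ^ (i : ℕ) := by
  have h : ((cellSet S).erase (S.orderEmbOfFin hS i : Cell)).filter
        (· < (S.orderEmbOfFin hS i : Cell)) =
      (Finset.Iio i).map ((S.orderEmbOfFin hS).toEmbedding.trans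
        (Function.Embedding.subtype _)) := by
    ext v
    simp only [Finset.mem_filter, Finset.mem_erase, Finset.mem_map, Finset.mem_Iio, cellSet]
    constructor
    · rintro ⟨⟨-, u, hu, rfl⟩, hlt⟩
      obtain ⟨j, rfl⟩ : ∃ j, S.orderEmbOfFin hS j = u := by
        have h : u ∈ Set.range (S.orderEmbOfFin hS) := by
          rw [Finset.range_orderEmbOfFin]
          exact hu
        exact h
      exact ⟨j, (S.orderEmbOfFin hS).lt_iff_lt.1 hlt, rfl⟩
    · rintro ⟨j, hj, rfl⟩
      have hlt : S.orderEmbOfFin hS j < S.orderEmbOfFin hS i := (S.orderEmbOfFin hS).strictMono hj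
      exact ⟨⟨fun h => hlt.ne (Subtype.ext h), _, S.orderEmbOfFin_mem hS j, rfl⟩, hlt⟩
  rw [koszulSign, h, Finset.card_map, Fin.card_Iio]

theorem sum_cellSet {M : Type*} [AddCommMonoid M] {T : Finset Cell} {n : ℕ} {S : Finset ↥T}
    (hS : S.card = n) (F : Cell → M) :
    ∑ s ∈ cellSet S, F s = ∑ i, F (S.orderEmbOfFin hS i : Cell) := by
  rw [cellSet, Finset.sum_map]
  conv_lhs => rw [← Finset.map_orderEmbOfFin_univ S hS]
  rw [Finset.sum_map]
  rfl

theorem cellSet_erase {T : Finset Cell} (S : Finset ↥T) (s : ↥T) :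
    cellSet (S.erase s) = (cellSet S).erase s :=
  Finset.map_erase _ _ _

theorem toFamily_koszul {a b : ℕ} {δ : KoszulMaps k a b} (hδ : IsKoszul k a b δ) (n q : ℕ)
    (z : (⋀[k]^(n+1) (RS k a b 1)) ⊗[k] (RS k a b q)) :
    toFamily k a b n (q + 1) (δ n q z) = totalOp (toFamily k a b (n + 1) q z) := by
  suffices h : (toFamily k a b n (q + 1)).comp (δ n q) =
      totalOp.comp (toFamily k a b (n + 1) q) from LinearMap.congr_fun h z
  refine (koszulBasis k a b (n + 1) q).ext fun ⟨⟨S, hS⟩, c⟩ => ?_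
  rw [LinearMap.comp_apply, LinearMap.comp_apply, toFamily_basis, totalOp_unitFamily,
    koszulBasis_apply, hδ, map_sum, sum_cellSet hS]
  refine Finset.sum_congr rfl fun i _ => ?_
  refine (map_smul _ _ _).trans (congrArg₂ _ (koszulSign_cellSet k hS i).symm ?_)
  have hS' : (S.erase (S.orderEmbOfFin hS i)).card = n := by
    rw [Finset.card_erase_of_mem (S.orderEmbOfFin_mem hS i), hS]
    rfl
  have h : koszulBasis k a b n (q + 1) (⟨S.erase (S.orderEmbOfFin hS i), hS'⟩,
      ⟨S.orderEmbOfFin hS i + c, add_mem_cellsBelow_succ_mul (Subtype.property _) c.2⟩) =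
      wedge k n (fun j => bihomBasis k (1 * a) (1 * b) (S.orderEmbOfFin hS (i.succAbove j))) ⊗ₜ[k]
        segMul k a b q (bihomBasis k (1 * a) (1 * b) (S.orderEmbOfFin hS i))
          (bihomBasis k (q * a) (q * b) c) := by
    rw [koszulBasis_apply, segMul_bihomBasis]
    simp only [Finset.orderEmbOfFin_succAbove hS i hS']
    rfl
  refine (congrArg _ h).symm.trans ?_
  rw [toFamily_basis, cellSet_erase]

end Intertwine

section Cohomology

open Finset.HasAntidiagonal (antidiagonal mem_antidiagonal)

variable {k : Type*} [Field k] {a b : ℕ} {δ : KoszulMaps k a b}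

theorem Submodule.finrank_quotient_comap_subtype_of_map_eq {V W : Type*} [AddCommGroup V]
    [Module k V] [AddCommGroup W] [Module k W] {f : V →ₗ[k] W} (hf : Function.Injective f)
    {B Z : Submodule k V} {B' Z' : Submodule k W} [Module.Finite k Z'] (hB : B.map f = B')
    (hZ : Z.map f = Z') (hle : B' ≤ Z') {N : ℕ}
    (hN : Module.finrank k Z' = Module.finrank k B' + N) :
    Module.finrank k (Z ⧸ B.comap Z.subtype) = N := by
  subst hB hZ
  rw [Submodule.map_le_map_iff_of_injective hf] at hle
  have e := Submodule.equivMapOfInjective f hf Z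
  have : Module.Finite k Z := Module.Finite.equiv e.symm
  have h := Submodule.finrank_quotient_add_finrank (B.comap Z.subtype)
  rw [(Submodule.comapSubtypeEquivOfLe hle).finrank_eq, e.finrank_eq, hN,
    ← (Submodule.equivMapOfInjective f hf B).finrank_eq] at h
  omega

theorem mem_families_one {p : ℕ} {ω : ℕ → ℕ → Finset Cell → k} :
    ω ∈ families k a b p 1 ↔ (∀ i j, ω i j ∈ forms k (cellsBelow a fun _ => b) p) ∧
      ∀ i j, ¬ (i ≤ a ∧ j ≤ b) → ω i j = 0 := by
  rw [← one_mul a, ← one_mul b]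
  simp only [one_mul]
  change (_ ∧ _) ↔ _
  simp only [one_mul]

theorem map_toFamily_ker (hδ : IsKoszul k a b δ) {n : ℕ} (hn : a * b + a ≤ n + 1) :
    (LinearMap.ker (δ n 1)).map (toFamily k a b (n + 1) 1) =
      blockCycles k a (fun _ => b) (n + 1) 0 := by
  have hker : ∀ z, z ∈ LinearMap.ker (δ n 1) ↔ totalOp (toFamily k a b (n + 1) 1 z) = 0 := by
    intro z
    rw [← toFamily_koszul k hδ, LinearMap.mem_ker, map_eq_zero_iff _ (toFamily_injective k a b _ _)]
  apply le_antisymm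
  · rintro _ ⟨z, hz, rfl⟩
    obtain ⟨h1, h2⟩ := mem_families_one.1
      (range_toFamily_le k a b (n + 1) 1 (LinearMap.mem_range_self _ z))
    refine mem_blockCycles.2 ⟨h1, fun i j hij => h2 i j fun h => hij ⟨h.1, j.zero_le, h.2⟩, ?_⟩
    exact pairRel_eq_zero_of_sum hn h1 (fun i j hi => h2 i j fun h => by omega)
      (fun i j hj => h2 i j fun h => by omega) fun r => congrFun ((hker z).1 hz) r
  · intro ω hω
    obtain ⟨h1, h2, h3⟩ := mem_blockCycles.1 hω
    have hmem : ω ∈ LinearMap.range (toFamily k a b (n + 1) 1) := by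
      rw [range_toFamily]
      exact mem_families_one.2 ⟨h1, fun i j hij => h2 i j fun h => hij ⟨h.1, h.2.2⟩⟩
    obtain ⟨z, rfl⟩ := hmem
    refine ⟨z, (hker z).2 ?_, rfl⟩
    ext1 r
    rw [totalOp_apply, sum_blockOp_eq_sum_pairRel]
    exact Finset.sum_eq_zero fun q _ => h3 _ _

theorem totalOp_eq_gradForm {p : ℕ} {ω : ℕ → ℕ → Finset Cell → k} (hω : ω ∈ families k a b p 0) :
    totalOp ω = gradForm (ω 0 0) := by
  have h0 : ∀ i j, ¬ (i = 0 ∧ j = 0) → ω i j = 0 := fun i j h =>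
    hω.2 i j (by rw [zero_mul, zero_mul]; omega)
  have hω0 : ω 0 = Pi.single 0 (ω 0 0) := by
    ext1 j
    rcases eq_or_ne j 0 with rfl | hj
    · rw [Pi.single_eq_same]
    · rw [Pi.single_eq_of_ne hj, h0 0 j fun h => hj h.2]
  ext1 r
  rw [gradForm_eq_blockOp, ← hω0, totalOp_apply,
    Finset.sum_eq_single_of_mem (r, 0) (mem_antidiagonal.2 (add_zero r))]
  rintro ⟨u, v⟩ huv hne
  rw [mem_antidiagonal] at huv
  have hv : v ≠ 0 := by
    rintro rfl
    exact hne (by rw [← huv]; rfl)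
  rw [show ω v = 0 from funext fun j => h0 v j fun h => hv h.1, map_zero]

theorem map_toFamily_range (hδ : IsKoszul k a b δ) (p : ℕ) :
    (LinearMap.range (δ p 0)).map (toFamily k a b p 1) = blockBoundaries k a b p := by
  apply le_antisymm
  · rintro _ ⟨_, ⟨z, rfl⟩, rfl⟩
    have hz : toFamily k a b (p + 1) 0 z ∈ families k a b (p + 1) 0 :=
      range_toFamily_le k a b (p + 1) 0 (LinearMap.mem_range_self _ z)
    exact ⟨_, hz.1 0 0, ((toFamily_koszul k hδ p 0 z).trans (totalOp_eq_gradForm hz)).symm⟩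
  · rintro _ ⟨η, hη, rfl⟩
    let ω : ℕ → ℕ → Finset Cell → k := Pi.single 0 (Pi.single 0 η)
    have hω : ω ∈ families k a b (p + 1) 0 := by
      refine ⟨fun i j => ?_, fun i j hij => ?_⟩
      · rcases eq_or_ne i 0 with rfl | hi
        · rcases eq_or_ne j 0 with rfl | hj
          · simpa [ω] using hη
          · simp [ω, hj]
        · simp [ω, hi]
      · rw [zero_mul, zero_mul] at hij
        rcases eq_or_ne i 0 with rfl | hi
        · have hj : j ≠ 0 := by omega
          simp [ω, hj]
        · simp [ω, hi]
    obtain ⟨z, hz⟩ : ω ∈ LinearMap.range (toFamily k a b (p + 1) 0) := by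
      rwa [range_toFamily]
    refine ⟨δ p 0 z, LinearMap.mem_range_self _ z, (toFamily_koszul k hδ p 0 z).trans ?_⟩
    rw [hz, totalOp_eq_gradForm hω]
    simp [ω]

end Cohomology

/-- Let `3 ≤ a ≤ b` and let `p ≥ ab + a` (we write `p = n+1`).  Then
`κ_{p,1} = p · C((a+1)b, p+1)`, where `κ_{p,1}` is the dimension of the Koszul cohomology
`K_{p,1} = ker δ_{p,1} / im δ_{p+1,0}` of the Segre–Veronese embedding of `ℙ¹×ℙ¹`
by `O(a)⊠O(b)`. -/
theorem segre_kappa_p1_of_ab_add_a_le (k : Type*) [Field k] (a b : ℕ)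
    (ha : 3 ≤ a) (hab : a ≤ b)
    (δ : KoszulMaps k a b) (hδ : IsKoszul k a b δ)
    (n : ℕ) (hn : a * b + a ≤ n + 1) :
    Module.finrank k (Kp1 k a b δ n) = (n + 1) * Nat.choose ((a + 1) * b) (n + 2) := by
  exact Submodule.finrank_quotient_comap_subtype_of_map_eq (toFamily_injective k a b (n + 1) 1)
    (map_toFamily_range hδ (n + 1)) (map_toFamily_ker hδ hn) blockBoundaries_le
    (finrank_blockCycles_zero a b (n + 1))

end
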